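/- Let P(∂) be an ℓ×k matrix with entries in A = ℂ[∂₁,…,∂ₙ] and let P ⊆ A^k be the submodule generated by its rows. Then the distributed system ℬ(P) is controllable if and only if the A-module A^k/P is torsion-free. -/

import Mathlib

noncomputable section

/-- The space of smooth (infinitely differentiable) functions `ℝⁿ → ℂ`,
as a `ℂ`-submodule of the space of all functions `ℝⁿ → ℂ`. -/
def Cinf (n : ℕ) : Submodule ℂ ((Fin n → ℝ) → ℂ) where
  carrier := {f | ContDiff ℝ (⊤ : ℕ∞) f}
  add_mem' := fun {f g} hf hg => by
    simp only [Set.mem_setOf_eq] at *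
    exact hf.add hg
  zero_mem' := by
    simp only [Set.mem_setOf_eq]
    exact contDiff_const
  smul_mem' := fun c f hf => by
    simp only [Set.mem_setOf_eq] at *
    exact hf.const_smul c

/-- The distributed system `ℬ(P)` defined by an `ℓ × k` matrix `M` of elements of
`A = ℂ[∂₁, …, ∂ₙ]`: the kernel `{f ∈ (C^∞)^k : M f = 0}` of the operator
`(C^∞)^k → (C^∞)^ℓ` given by `M`, where `A` acts on `C^∞` via a given module structure. -/
def system {n ℓ k : ℕ} [Module (MvPolynomial (Fin n) ℂ) (Cinf n)]
    (M : Matrix (Fin ℓ) (Fin k) (MvPolynomial (Fin n) ℂ)) : Set (Fin k → Cinf n) :=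
  {f | ∀ i : Fin ℓ, ∑ j, M i j • f j = 0}

/-- A behaviour `B ⊆ (C^∞)^k` is controllable if for any two subsets `U₁, U₂` of `ℝⁿ`
whose closures do not intersect, and any `f₁, f₂ ∈ B`, there is an `f ∈ B` agreeing with
`f₁` on a neighbourhood of `U₁` and with `f₂` on a neighbourhood of `U₂`. -/
def IsControllable {n k : ℕ} (B : Set (Fin k → Cinf n)) : Prop :=
  ∀ U₁ U₂ : Set (Fin n → ℝ), closure U₁ ∩ closure U₂ = ∅ →
    ∀ f₁ ∈ B, ∀ f₂ ∈ B, ∃ f ∈ B, ∃ V₁ V₂ : Set (Fin n → ℝ),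
      IsOpen V₁ ∧ IsOpen V₂ ∧ U₁ ⊆ V₁ ∧ U₂ ⊆ V₂ ∧
      (∀ x ∈ V₁, ∀ j, (f j : (Fin n → ℝ) → ℂ) x = (f₁ j : (Fin n → ℝ) → ℂ) x) ∧
      (∀ x ∈ V₂, ∀ j, (f j : (Fin n → ℝ) → ℂ) x = (f₂ j : (Fin n → ℝ) → ℂ) x)

noncomputable section

/-! ## Algebra -/

section Algebra

open Polynomial TensorProduct

theorem baer_restrict {B A M : Type*} [CommRing B] [CommRing A] [Algebra B A] [Module.Flat B A]
    [AddCommGroup M] [Module A M] [Module B M] [IsScalarTower B A M] (h : Module.Baer A M) :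
    Module.Baer B M := by
  intro I g
  have hinj : Function.Injective (LinearMap.baseChange A (Submodule.subtype I)) := by
    have := Module.Flat.lTensor_preserves_injective_linearMap (M := A) (Submodule.subtype I)
      Subtype.val_injective
    exact this
  obtain ⟨k, hk⟩ := h.extension_property _ hinj (LinearMap.liftBaseChange A g)
  refine ⟨LinearMap.toSpanSingleton B M (k (1 ⊗ₜ 1)), fun x hx => ?_⟩
  have h1 := LinearMap.congr_fun hk ((1 : A) ⊗ₜ (⟨x, hx⟩ : I))
  simp only [LinearMap.comp_apply, LinearMap.baseChange_tmul, LinearMap.liftBaseChange_tmul,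
    one_smul, Submodule.subtype_apply] at h1
  rw [← h1, LinearMap.toSpanSingleton_apply]
  have : (1 : A) ⊗ₜ[B] x = algebraMap B A x • ((1 : A) ⊗ₜ[B] (1 : B)) := by
    rw [TensorProduct.smul_tmul', smul_eq_mul, mul_one, Algebra.algebraMap_eq_smul_one,
      TensorProduct.smul_tmul, smul_eq_mul, mul_one]
  rw [this, map_smul, algebraMap_smul]

theorem delta_surj {B A M N : Type*} [CommRing B] [CommRing A] [Algebra B A]
    [AddCommGroup M] [Module A M] [Module B M] [IsScalarTower B A M]
    [AddCommGroup N] [Module A N] [Module B N] [IsScalarTower B A N]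
    (t : A) (ht : Function.Bijective (Polynomial.aeval t : B[X] →ₐ[B] A))
    (h : Module.Baer A M) (Ψ : N →ₗ[B] M) :
    ∃ Φ : N →ₗ[B] M, ∀ n, t • Φ n - Φ (t • n) = Ψ n := by
  let e : B[X] ≃ₐ[B] A := AlgEquiv.ofBijective _ ht
  let tM : M →ₗ[B] M := (LinearMap.lsmul A M t).restrictScalars B
  let tN : N →ₗ[B] N := (LinearMap.lsmul A N t).restrictScalars B
  let T : (M × N) →ₗ[B] (M × N) :=
    LinearMap.prod (tM.comp (LinearMap.fst B M N) + Ψ.comp (LinearMap.snd B M N))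
      (tN.comp (LinearMap.snd B M N))
  let Q := Module.AEval' T
  let _ : Module A Q := Module.compHom Q (e.symm : A →+* B[X])
  have hsm : ∀ (a : A) (q : Q), a • q = (e.symm a) • q := fun a q => rfl
  let of := Module.AEval'.of T
  have hX : ∀ q, (X : B[X]) • of q = of (T q) := fun q => Module.AEval'.X_smul_of T q
  have hC : ∀ (b : B) q, (C b : B[X]) • of q = of (b • q) := fun b q => by
    rw [Polynomial.C_eq_algebraMap, algebraMap_smul, map_smul]
  have key : ∀ (p : B[X]) (m : M), p • of (m, 0) = of (aeval t p • m, 0) := by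
    intro p
    induction p using Polynomial.induction_on' with
    | add p q hp hq =>
      intro m
      rw [add_smul, hp, hq, ← map_add, map_add (aeval t), add_smul, Prod.mk_add_mk, add_zero]
    | monomial k b =>
      induction k with
      | zero =>
        intro m
        rw [Polynomial.monomial_zero_left, hC]; simp
      | succ k ih =>
        intro m
        rw [← Polynomial.monomial_mul_X, mul_smul, hX]
        have : T (m, 0) = (t • m, 0) := by simp [T, tM, tN]
        rw [this, ih, map_mul, aeval_X, mul_smul]
  let ι : M →ₗ[A] Q :=
    { toFun := fun m => of (m, 0)
      map_add' := fun a b => by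
        rw [← map_add, Prod.mk_add_mk, add_zero]
      map_smul' := fun a m => by
        rw [RingHom.id_apply, hsm, key]
        congr 2
        exact congrArg (fun z => z • m) (e.apply_symm_apply a).symm }
  have hι : Function.Injective ι := by
    intro a b hab
    have := of.injective hab
    exact (Prod.mk.inj this).1
  obtain ⟨r, hr⟩ := h.extension_property ι hι LinearMap.id
  have hr' : ∀ m, r (of (m, 0)) = m := fun m => LinearMap.congr_fun hr m
  have het : e.symm t = X := by
    rw [AlgEquiv.symm_apply_eq]; simp [e]
  refine ⟨{ toFun := fun n => r (of (0, n)), map_add' := ?_, map_smul' := ?_ }, ?_⟩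
  · intro a b
    rw [← map_add, ← map_add, Prod.mk_add_mk, add_zero]
  · intro b n
    have h1 : of (0, b • n) = (algebraMap B A b) • of ((0 : M), n) := by
      rw [hsm, AlgEquiv.commutes, ← Polynomial.C_eq_algebraMap, hC, Prod.smul_mk, smul_zero]
    rw [h1, map_smul, algebraMap_smul, RingHom.id_apply]
  · intro n
    simp only [LinearMap.coe_mk, AddHom.coe_mk]
    rw [← map_smul, hsm, het, hX]
    have : T (0, n) = (Ψ n, 0) + (0, t • n) := by simp [T, tM, tN]
    rw [this, map_add, map_add, hr']
    simp

end Algebra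

section Poly

open MvPolynomial

variable {n : ℕ} {K : Type} [CommRing K]

theorem exists_aeval_supported (S : Set (Fin n)) (j : Fin n) (p : MvPolynomial (Fin n) K)
    (hp : p ∈ supported K (insert j S)) :
    ∃ q : Polynomial (supported K S), Polynomial.aeval (X j : MvPolynomial (Fin n) K) q = p := by
  rw [supported_eq_adjoin_X] at hp
  induction hp using Algebra.adjoin_induction with
  | mem x hx =>
    obtain ⟨m, hm, rfl⟩ := hx
    rcases hm with rfl | hm
    · exact ⟨Polynomial.X, by simp⟩
    · exact ⟨Polynomial.C ⟨X m, by
        rw [supported_eq_adjoin_X]; exact Algebra.subset_adjoin ⟨m, hm, rfl⟩⟩, by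
          simp⟩
  | algebraMap r => exact ⟨algebraMap K _ r, by simp⟩
  | add x y _ _ hx hy =>
    obtain ⟨a, rfl⟩ := hx
    obtain ⟨b, rfl⟩ := hy
    exact ⟨a + b, by simp⟩
  | mul x y _ _ hx hy =>
    obtain ⟨a, rfl⟩ := hx
    obtain ⟨b, rfl⟩ := hy
    exact ⟨a * b, by simp⟩

/-- the ring of operators not involving `∂_j` -/
abbrev Bring (n : ℕ) (K : Type) [CommRing K] (j : Fin n) : Subalgebra K (MvPolynomial (Fin n) K) :=
  supported K ({j}ᶜ : Set (Fin n))

theorem aeval_bij (j : Fin n) : Function.Bijective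
    (Polynomial.aeval (X j : MvPolynomial (Fin n) K) :
      Polynomial (Bring n K j) →ₐ[Bring n K j] MvPolynomial (Fin n) K) := by
  constructor
  · exact transcendental_iff_injective.1 (transcendental_supported_X K (by simp))
  · intro p
    apply exists_aeval_supported
    have : insert j ({j}ᶜ : Set (Fin n)) = Set.univ := by
      ext x; simp [em]
    rw [this, supported_univ]; trivial

instance flatB (j : Fin n) : Module.Flat (Bring n K j) (MvPolynomial (Fin n) K) :=
  Module.Flat.of_linearEquiv (AlgEquiv.ofBijective _ (aeval_bij (K := K) j)).symm.toLinearEquiv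

/-- additive maps commuting with constants and with all `X m`, `m ≠ j`, are `B`-linear -/
theorem comm_B (j : Fin n) {M N : Type} [AddCommGroup M] [Module (MvPolynomial (Fin n) K) M]
    [AddCommGroup N] [Module (MvPolynomial (Fin n) K) N] (f : M →+ N)
    (hC : ∀ (c : K) m, f ((C c : MvPolynomial (Fin n) K) • m) = (C c : MvPolynomial (Fin n) K) • f m)
    (hX : ∀ (i : Fin n), i ≠ j → ∀ m, f ((X i : MvPolynomial (Fin n) K) • m)
      = (X i : MvPolynomial (Fin n) K) • f m)
    (b : Bring n K j) (m : M) : f (b • m) = b • f m := by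
  obtain ⟨b, hb⟩ := b
  change f (b • m) = b • f m
  rw [Bring, supported_eq_adjoin_X] at hb
  induction hb using Algebra.adjoin_induction generalizing m with
  | mem x hx =>
    obtain ⟨i, hi, rfl⟩ := hx
    exact hX i hi m
  | algebraMap r => exact hC r m
  | add x y _ _ hx hy => rw [add_smul, map_add, hx, hy, add_smul]
  | mul x y _ _ hx hy => rw [mul_smul, hx, hy, mul_smul]

theorem comm_A {M N : Type} [AddCommGroup M] [Module (MvPolynomial (Fin n) K) M]
    [AddCommGroup N] [Module (MvPolynomial (Fin n) K) N] (f : M →+ N)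
    (hC : ∀ (c : K) m, f ((C c : MvPolynomial (Fin n) K) • m) = (C c : MvPolynomial (Fin n) K) • f m)
    (hX : ∀ (i : Fin n) m, f ((X i : MvPolynomial (Fin n) K) • m)
      = (X i : MvPolynomial (Fin n) K) • f m)
    (b : MvPolynomial (Fin n) K) (m : M) : f (b • m) = b • f m := by
  induction b using MvPolynomial.induction_on generalizing m with
  | C r => exact hC r m
  | add x y hx hy => rw [add_smul, map_add, hx, hy, add_smul]
  | mul_X p i hp => rw [mul_smul, hp, hX, mul_smul]

/-- solving the `δ`-equation modulo an ideal -/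
theorem delta_ideal (j : Fin n) {M : Type} [AddCommGroup M] [Module (MvPolynomial (Fin n) K) M]
    (h : Module.Baer (MvPolynomial (Fin n) K) M) (J : Ideal (MvPolynomial (Fin n) K))
    (Ψ : MvPolynomial (Fin n) K →ₗ[Bring n K j] M) (hΨ : ∀ p ∈ J, Ψ p = 0) :
    ∃ Φ : MvPolynomial (Fin n) K →ₗ[Bring n K j] M, (∀ p ∈ J, Φ p = 0) ∧
      ∀ a, (X j : MvPolynomial (Fin n) K) • Φ a - Φ (X j * a) = Ψ a := by
  let J' : Submodule (Bring n K j) (MvPolynomial (Fin n) K) :=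
    Submodule.restrictScalars (Bring n K j) J
  let Ψ' : (MvPolynomial (Fin n) K ⧸ J) →ₗ[Bring n K j] M :=
    { toFun := fun q => Quotient.liftOn' q Ψ (fun a b hab => by
        have hab' : a - b ∈ J := (Submodule.quotientRel_def J).1 hab
        have := hΨ _ hab'
        rw [map_sub] at this
        exact sub_eq_zero.1 this)
      map_add' := fun a b => by
        induction a using Submodule.Quotient.induction_on with | H a => ?_
        induction b using Submodule.Quotient.induction_on with | H b => ?_
        exact map_add Ψ a b
      map_smul' := fun c a => by
        induction a using Submodule.Quotient.induction_on with | H a => ?_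
        exact map_smul Ψ c a }
  obtain ⟨Φ, hΦ⟩ := delta_surj (X j : MvPolynomial (Fin n) K) (aeval_bij j) h Ψ'
  refine ⟨Φ.comp ((Submodule.mkQ J).restrictScalars (Bring n K j)), fun p hp => ?_, fun a => ?_⟩
  · have : Submodule.mkQ J p = 0 := (Submodule.Quotient.mk_eq_zero J).2 hp
    simp only [LinearMap.comp_apply, LinearMap.restrictScalars_apply]
    rw [this, map_zero]
  · exact hΦ (Submodule.mkQ J a)

/-- extension of `B`-linear maps from ideals -/
theorem ext_ideal (j : Fin n) {M : Type} [AddCommGroup M] [Module (MvPolynomial (Fin n) K) M]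
    (h : Module.Baer (MvPolynomial (Fin n) K) M) (J : Ideal (MvPolynomial (Fin n) K))
    (φ : J →ₗ[Bring n K j] M) :
    ∃ Φ : MvPolynomial (Fin n) K →ₗ[Bring n K j] M, ∀ p (hp : p ∈ J), Φ p = φ ⟨p, hp⟩ := by
  have hB : Module.Baer (Bring n K j) M := baer_restrict h
  obtain ⟨Φ, hΦ⟩ := hB.extension_property ((Submodule.subtype J).restrictScalars (Bring n K j))
    Subtype.val_injective φ
  exact ⟨Φ, fun p hp => LinearMap.congr_fun hΦ ⟨p, hp⟩⟩

end Poly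

end

noncomputable section
open MvPolynomial
open scoped ContDiff

/-! ## Smooth functions as a module -/

class DMod (n : ℕ) (K : Type) [CommRing K] [Algebra K ℂ]
    [Module (MvPolynomial (Fin n) K) (Cinf n)] : Prop where
  X_smul : ∀ (i : Fin n) (f : Cinf n),
      (((X i : MvPolynomial (Fin n) K) • f : Cinf n) : (Fin n → ℝ) → ℂ) =
        fun x => fderiv ℝ (f : (Fin n → ℝ) → ℂ) x (Pi.single i 1)
  C_smul : ∀ (c : K) (f : Cinf n),
      ((C c : MvPolynomial (Fin n) K) • f : Cinf n) = (algebraMap K ℂ c) • f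

section Basic

variable {n : ℕ}

/-- the linear form with given partial derivatives -/
def gradCLM (a : Fin n → ℂ) : (Fin n → ℝ) →L[ℝ] ℂ :=
  ∑ m, (ContinuousLinearMap.proj (R := ℝ) (φ := fun _ : Fin n => ℝ) m).smulRight (a m)

theorem gradCLM_apply (a : Fin n → ℂ) (v : Fin n → ℝ) : gradCLM a v = ∑ m, (v m : ℂ) * a m := by
  simp [gradCLM]

theorem gradCLM_norm_le (a : Fin n → ℂ) : ‖gradCLM a‖ ≤ ∑ m, ‖a m‖ := by
  refine ContinuousLinearMap.opNorm_le_bound _ (by positivity) fun v => ?_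
  rw [gradCLM_apply, Finset.sum_mul]
  refine (norm_sum_le _ _).trans (Finset.sum_le_sum fun m _ => ?_)
  rw [norm_mul, mul_comm]
  gcongr
  simpa using norm_le_pi_norm v m

theorem gradCLM_single (a : Fin n → ℂ) (i : Fin n) : gradCLM a (Pi.single i 1) = a i := by
  rw [gradCLM_apply, Finset.sum_eq_single i]
  · simp
  · intro b _ hb; simp [hb]
  · simp

theorem clm_eq_grad (L : (Fin n → ℝ) →L[ℝ] ℂ) : L = gradCLM (fun m => L (Pi.single m 1)) := by
  ext v
  rw [gradCLM_apply]
  conv_lhs => rw [← Finset.univ_sum_single v]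
  rw [map_sum]
  refine Finset.sum_congr rfl fun m _ => ?_
  have : Pi.single m (v m) = v m • (Pi.single m 1 : Fin n → ℝ) := by
    rw [← Pi.single_smul]; simp
  rw [this, map_smul]; simp

theorem smooth_of_closed (G : Set ((Fin n → ℝ) → ℂ))
    (h : ∀ f ∈ G, ∃ g : Fin n → (Fin n → ℝ) → ℂ, (∀ m, g m ∈ G) ∧
      ∀ x, HasFDerivAt f (gradCLM fun m => g m x) x) :
    ∀ f ∈ G, ContDiff ℝ ∞ f := by
  have key : ∀ N : ℕ, ∀ f ∈ G, ContDiff ℝ N f := by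
    intro N
    induction N with
    | zero =>
      intro f hf
      obtain ⟨g, _, hg⟩ := h f hf
      simp only [Nat.cast_zero, contDiff_zero]
      exact continuous_iff_continuousAt.2 fun x => (hg x).continuousAt
    | succ N ih =>
      intro f hf
      obtain ⟨g, hgG, hg⟩ := h f hf
      have := (contDiff_succ_iff_hasFDerivAt (𝕜 := ℝ) (n := N) (f := f)).2
        ⟨fun x => gradCLM fun m => g m x, ?_, hg⟩
      · exact_mod_cast this
      · unfold gradCLM
        refine ContDiff.sum fun m _ => ?_
        exact contDiff_const.smulRight (ih _ (hgG m))
  intro f hf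
  exact contDiff_infty.2 fun N => key N f hf

theorem Cinf.contDiff (f : Cinf n) : ContDiff ℝ ∞ f.1 := f.2

theorem Cinf.continuous (f : Cinf n) : Continuous f.1 := (Cinf.contDiff f).continuous

theorem Cinf.differentiable (f : Cinf n) : Differentiable ℝ f.1 :=
  (Cinf.contDiff f).differentiable (by simp)

variable {K : Type} [CommRing K] [Algebra K ℂ] [Module (MvPolynomial (Fin n) K) (Cinf n)]
  [DMod n K]

variable (K) in
theorem X_smul_apply (i : Fin n) (f : Cinf n) (x : Fin n → ℝ) :
    ((X i : MvPolynomial (Fin n) K) • f).1 x = fderiv ℝ f.1 x (Pi.single i 1) :=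
  congrFun (DMod.X_smul (K := K) i f) x

variable (K) in
theorem hasFDerivAt_C (f : Cinf n) (x : Fin n → ℝ) :
    HasFDerivAt f.1 (gradCLM fun m => ((X m : MvPolynomial (Fin n) K) • f).1 x) x := by
  have h := (Cinf.differentiable f x).hasFDerivAt
  rw [clm_eq_grad (fderiv ℝ f.1 x)] at h
  convert h using 3 with m
  rw [X_smul_apply]

variable (K) in
theorem X_smul_of_hasFDerivAt (f : Cinf n) (x : Fin n → ℝ) (a : Fin n → ℂ)
    (h : HasFDerivAt f.1 (gradCLM a) x) (m : Fin n) :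
    ((X m : MvPolynomial (Fin n) K) • f).1 x = a m := by
  rw [X_smul_apply, h.fderiv, gradCLM_single]

theorem C_smul_apply (c : K) (f : Cinf n) (x : Fin n → ℝ) :
    ((C c : MvPolynomial (Fin n) K) • f).1 x = algebraMap K ℂ c * f.1 x := by
  rw [DMod.C_smul]; rfl

theorem poly_smul_csmul (p : MvPolynomial (Fin n) K) (c : ℂ) (f : Cinf n) :
    p • (c • f) = c • (p • f) := by
  symm
  refine comm_A (K := K) (DistribSMul.toAddMonoidHom (Cinf n) c) ?_ ?_ p f
  · intro a f
    simp only [DistribSMul.toAddMonoidHom_apply, DMod.C_smul]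
    rw [smul_comm]
  · intro i f
    simp only [DistribSMul.toAddMonoidHom_apply]
    apply Subtype.ext
    funext x
    rw [X_smul_apply]
    change c • (((X i : MvPolynomial (Fin n) K) • f).1 x) = fderiv ℝ (c • f.1) x _
    rw [X_smul_apply, fderiv_const_smul (Cinf.differentiable f x)]
    rfl

theorem poly_smul_congr (p : MvPolynomial (Fin n) K) (U : Set (Fin n → ℝ)) (hU : IsOpen U)
    (f g : Cinf n) (h : ∀ x ∈ U, f.1 x = g.1 x) : ∀ x ∈ U, (p • f).1 x = (p • g).1 x := by
  induction p using MvPolynomial.induction_on generalizing f g with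
  | C c => intro x hx; rw [C_smul_apply, C_smul_apply, h x hx]
  | add p q hp hq =>
    intro x hx
    rw [add_smul, add_smul]
    change (p • f).1 x + (q • f).1 x = (p • g).1 x + (q • g).1 x
    rw [hp f g h x hx, hq f g h x hx]
  | mul_X p i hp =>
    intro x hx
    rw [mul_smul, mul_smul]
    refine hp _ _ (fun y hy => ?_) x hx
    rw [X_smul_apply, X_smul_apply]
    congr 1
    apply Filter.EventuallyEq.fderiv_eq
    filter_upwards [hU.mem_nhds hy] with z hz using h z hz

/-- multiplication by a smooth function of `x_j` -/
def mulT (j : Fin n) (ρ : ℝ → ℂ) (hρ : ContDiff ℝ ∞ ρ) : Cinf n →+ Cinf n where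
  toFun f := ⟨fun x => ρ (x j) * f.1 x, by
    change ContDiff ℝ ∞ _
    exact (hρ.comp (contDiff_apply ℝ ℝ j)).mul (Cinf.contDiff f)⟩
  map_zero' := by apply Subtype.ext; funext x; change ρ (x j) * 0 = 0; simp
  map_add' f g := by
    apply Subtype.ext; funext x
    change ρ (x j) * (f.1 x + g.1 x) = ρ (x j) * f.1 x + ρ (x j) * g.1 x
    ring

theorem mulT_apply (j : Fin n) (ρ : ℝ → ℂ) (hρ : ContDiff ℝ ∞ ρ) (f : Cinf n) (x : Fin n → ℝ) :
    (mulT j ρ hρ f).1 x = ρ (x j) * f.1 x := rfl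

variable (K) in
theorem X_mulT (j m : Fin n) (ρ : ℝ → ℂ) (hρ : ContDiff ℝ ∞ ρ) (f : Cinf n) :
    (X m : MvPolynomial (Fin n) K) • mulT j ρ hρ f =
      mulT j ρ hρ ((X m : MvPolynomial (Fin n) K) • f) +
        if m = j then mulT j (deriv ρ) (contDiff_infty_iff_deriv.1 hρ).2 f else 0 := by
  have key : ∀ x, ((X m : MvPolynomial (Fin n) K) • mulT j ρ hρ f).1 x =
      ρ (x j) * ((X m : MvPolynomial (Fin n) K) • f).1 x +
        (if m = j then deriv ρ (x j) else 0) * f.1 x := by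
    intro x
    rw [X_smul_apply, X_smul_apply]
    have hd : HasFDerivAt (fun y : Fin n → ℝ => ρ (y j))
        ((ContinuousLinearMap.proj (R := ℝ) (φ := fun _ : Fin n => ℝ) j).smulRight
          (deriv ρ (x j))) x := by
      have h1 : HasDerivAt ρ (deriv ρ (x j)) (x j) :=
        ((contDiff_infty_iff_deriv.1 hρ).1 _).hasDerivAt
      have h2 := (ContinuousLinearMap.proj (R := ℝ) (φ := fun _ : Fin n => ℝ) j).hasFDerivAt (x := x)
      have h3 := HasFDerivAt.comp (g := ρ) (f := fun y : Fin n → ℝ => y j) x h1.hasFDerivAt h2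
      have h6 : (ContinuousLinearMap.proj (R := ℝ) (φ := fun _ : Fin n => ℝ) j).smulRight
          (deriv ρ (x j)) = (ContinuousLinearMap.toSpanSingleton ℝ (deriv ρ (x j))).comp
            (ContinuousLinearMap.proj (R := ℝ) (φ := fun _ : Fin n => ℝ) j) := by
        ext v; simp
      rw [h6]
      exact h3
    have h4 := hd.mul (Cinf.differentiable f x).hasFDerivAt
    have h5 : fderiv ℝ (mulT j ρ hρ f).1 x = _ := h4.fderiv
    rw [h5]
    by_cases hm : m = j
    · subst hm; simp; ring
    · simp [hm, Ne.symm hm]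
  apply Subtype.ext; funext x
  rw [key]
  by_cases hm : m = j
  · simp only [hm, if_true]; rfl
  · simp only [hm, if_false, add_zero, zero_mul]; rfl

end Basic

end

noncomputable section
open MvPolynomial
open scoped ContDiff

/-! ## The auxiliary spaces -/

section WSpace

variable {n : ℕ}

def slice (n : ℕ) (j : ℕ) (R : ℝ) : Set (Fin n → ℝ) :=
  {x | ∀ m : Fin n, |x m| ≤ R ∧ (j ≤ m.val → x m = 0)}

/-- set the coordinates with index `≥ j` to zero -/
def projj (j : ℕ) (x : Fin n → ℝ) : Fin n → ℝ := fun m => if j ≤ m.val then 0 else x m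

theorem projj_mem (j : ℕ) (x : Fin n → ℝ) (R : ℝ) (h : ∀ m, |x m| ≤ R) : projj j x ∈ slice n j R := by
  intro m
  unfold projj
  refine ⟨?_, fun hm => by simp [hm]⟩
  split_ifs
  · simpa using (abs_nonneg _).trans (h m)
  · exact h m

variable (K : Type) [CommRing K] [Algebra K ℂ] [Module (MvPolynomial (Fin n) K) (Cinf n)]

variable [DMod n K]

theorem zero_apply' (x : Fin n → ℝ) : (0 : Cinf n).1 x = 0 := rfl

theorem add_apply' (f g : Cinf n) (x : Fin n → ℝ) : (f + g).1 x = f.1 x + g.1 x := rfl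

theorem sub_apply' (f g : Cinf n) (x : Fin n → ℝ) : (f - g).1 x = f.1 x - g.1 x := rfl

theorem csmul_apply' (c : ℂ) (f : Cinf n) (x : Fin n → ℝ) : (c • f).1 x = c * f.1 x := rfl

def W (j : ℕ) {I : Type} (τ : I → Fin n → ℂ) (w : I → ℝ) :
    Submodule (MvPolynomial (Fin n) K) (I → Cinf n) where
  carrier := {u | (∀ i (m : Fin n), j ≤ m.val →
        (X m : MvPolynomial (Fin n) K) • u i = τ i m • u i) ∧
      ∀ (p : MvPolynomial (Fin n) K) (N : ℕ) (R : ℝ), ∃ C : ℝ, ∀ i, ∀ x ∈ slice n j R,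
        ‖(p • u i).1 x‖ * |w i| ^ N ≤ C}
  add_mem' := by
    rintro u v ⟨hu, hu'⟩ ⟨hv, hv'⟩
    refine ⟨fun i m hm => ?_, fun p N R => ?_⟩
    · rw [Pi.add_apply, smul_add, hu i m hm, hv i m hm, smul_add]
    · obtain ⟨C, hC⟩ := hu' p N R
      obtain ⟨D, hD⟩ := hv' p N R
      refine ⟨C + D, fun i x hx => ?_⟩
      rw [Pi.add_apply, smul_add, add_apply']
      refine le_trans ?_ (add_le_add (hC i x hx) (hD i x hx))
      rw [← add_mul]
      gcongr
      exact norm_add_le _ _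
  zero_mem' := by
    refine ⟨fun i m hm => by simp, fun p N R => ⟨0, fun i x hx => ?_⟩⟩
    rw [Pi.zero_apply, smul_zero, zero_apply']; simp
  smul_mem' := by
    rintro q u ⟨hu, hu'⟩
    refine ⟨fun i m hm => ?_, fun p N R => ?_⟩
    · rw [Pi.smul_apply, smul_comm, hu i m hm, poly_smul_csmul]
    · obtain ⟨C, hC⟩ := hu' (p * q) N R
      refine ⟨C, fun i x hx => ?_⟩
      rw [Pi.smul_apply, ← mul_smul]
      exact hC i x hx

instance instModW (j : ℕ) {I : Type} (τ : I → Fin n → ℂ) (w : I → ℝ) :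
    Module (MvPolynomial (Fin n) K) (W K j τ w) := Submodule.module _

instance instSMulW (j : ℕ) {I : Type} (τ : I → Fin n → ℂ) (w : I → ℝ) :
    SMul (MvPolynomial (Fin n) K) (W K j τ w) := (instModW K j τ w).toSMul

variable {K} in
theorem freq_formula (j : ℕ) (τ : Fin n → ℂ) (u : Cinf n)
    (hu : ∀ m : Fin n, j ≤ m.val → (X m : MvPolynomial (Fin n) K) • u = τ m • u)
    (x : Fin n → ℝ) :
    u.1 x = Complex.exp (∑ m : Fin n, if j ≤ m.val then τ m * x m else 0) * u.1 (projj j x) := by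
  set a : ℂ := ∑ m : Fin n, if j ≤ m.val then τ m * x m else 0 with ha
  let v : Fin n → ℝ := x - projj j x
  let g : ℝ → ℂ := fun s => Complex.exp (-(s * a)) * u.1 (projj j x + s • v)
  have hg : ∀ s, HasDerivAt g 0 s := by
    intro s
    have h1 : HasDerivAt (fun s : ℝ => Complex.exp (-(s * a)))
        (Complex.exp (-(s * a)) * (-(1 * a))) s := by
      have := ((Complex.ofRealCLM.hasDerivAt (x := s)).mul_const a).neg.cexp
      simpa using this
    have h2 : HasDerivAt (fun s : ℝ => projj j x + s • v) v s := by
      simpa using ((hasDerivAt_id s).smul_const v).const_add (projj j x)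
    have h3 := (hasFDerivAt_C K u (projj j x + s • v)).comp_hasDerivAt s h2
    have h4 := h1.mul h3
    rw [gradCLM_apply] at h4
    have : ∑ m, (v m : ℂ) * ((X m : MvPolynomial (Fin n) K) • u).1 (projj j x + s • v) =
        a * u.1 (projj j x + s • v) := by
      rw [ha, Finset.sum_mul]
      refine Finset.sum_congr rfl fun m _ => ?_
      by_cases hm : j ≤ m.val
      · rw [hu m hm, csmul_apply']
        simp [v, projj, hm]; ring
      · simp [v, projj, hm]
    rw [this] at h4
    simp only [Function.comp] at h4
    have h5 : ∀ e b : ℂ, e * (-(1 * a)) * b + e * (a * b) = 0 := fun e b => by ring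
    rw [h5] at h4
    exact h4
  have h01 : g 0 = g 1 := is_const_of_deriv_eq_zero (fun s => (hg s).differentiableAt)
    (fun s => (hg s).deriv) 0 1
  simp only [g, v] at h01
  simp only [Complex.ofReal_zero, zero_mul, neg_zero, Complex.exp_zero, one_mul, zero_smul,
    add_zero, Complex.ofReal_one, one_smul, add_sub_cancel] at h01
  rw [h01, ← mul_assoc, ← Complex.exp_add, add_neg_cancel, Complex.exp_zero, one_mul]

structure Good (j : ℕ) {I : Type} (τ : I → Fin n → ℂ) (w : I → ℝ) : Prop where
  one_le : ∀ i, 1 ≤ w i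
  summ : ∃ M : ℕ, Summable fun i => (w i ^ M)⁻¹
  low : ∀ p ∈ supported K {m : Fin n | j ≤ m.val}, p ≠ 0 → ∃ c : ℝ, 0 < c ∧ ∃ N : ℕ, ∀ i,
    c ≤ ‖aeval (τ i) p‖ * w i ^ N

variable {K}

theorem smul_eq_aeval (τ : Fin n → ℂ) (u : Cinf n)
    (hu : ∀ m : Fin n, (X m : MvPolynomial (Fin n) K) • u = τ m • u)
    (p : MvPolynomial (Fin n) K) : p • u = (aeval τ p : ℂ) • u := by
  induction p using MvPolynomial.induction_on with
  | C c => rw [DMod.C_smul]; simp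
  | add p q hp hq => rw [add_smul, hp, hq, map_add, add_smul]
  | mul_X p i hp =>
    rw [mul_smul, hu, poly_smul_csmul, hp, map_mul, aeval_X, mul_comm, mul_smul]

theorem baer_zero {I : Type} (τ : I → Fin n → ℂ) (w : I → ℝ) (hg : Good K 0 τ w) :
    Module.Baer (MvPolynomial (Fin n) K) (W K 0 τ w) := by
  intro J φ
  by_cases hJ : ∀ p ∈ J, p = 0
  · refine ⟨0, fun x hx => ?_⟩
    have : (⟨x, hx⟩ : J) = 0 := Subtype.ext (hJ x hx)
    rw [this, map_zero, LinearMap.zero_apply]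
  push Not at hJ
  obtain ⟨p, hpJ, hp0⟩ := hJ
  obtain ⟨c, hc, N₀, hlow⟩ := hg.low p (by simp) hp0
  let v := φ ⟨p, hpJ⟩
  have hne : ∀ i, aeval (τ i) p ≠ 0 := by
    intro i h0
    have := hlow i
    rw [h0, norm_zero, zero_mul] at this
    linarith
  have hfr : ∀ (z : W K 0 τ w) i q, q • z.1 i = (aeval (τ i) q : ℂ) • z.1 i := fun z i q =>
    smul_eq_aeval _ _ (fun m => z.2.1 i m (Nat.zero_le _)) q
  let f : I → Cinf n := fun i => (aeval (τ i) p)⁻¹ • v.1 i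
  have hf : f ∈ W K 0 τ w := by
    refine ⟨fun i m hm => ?_, fun q N R => ?_⟩
    · simp only [f]
      rw [poly_smul_csmul, v.2.1 i m hm, smul_comm]
    · obtain ⟨C, hC⟩ := v.2.2 q (N + N₀) R
      refine ⟨c⁻¹ * C, fun i x hx => ?_⟩
      simp only [f]
      rw [poly_smul_csmul, csmul_apply', norm_mul, norm_inv]
      have h1 := hC i x hx
      have h2 := hlow i
      have hw : 0 < w i := zero_lt_one.trans_le (hg.one_le i)
      rw [abs_of_pos hw] at h1 ⊢
      have h3 : 0 < ‖aeval (τ i) p‖ := norm_pos_iff.2 (hne i)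
      have h4 : ‖aeval (τ i) p‖⁻¹ ≤ c⁻¹ * w i ^ N₀ := by
        rw [inv_le_iff_one_le_mul₀ h3]
        have : 1 ≤ c⁻¹ * (‖aeval (τ i) p‖ * w i ^ N₀) := by
          rw [← inv_mul_cancel₀ hc.ne']
          gcongr
        linarith
      calc _ ≤ c⁻¹ * w i ^ N₀ * ‖(q • v.1 i).1 x‖ * w i ^ N := by gcongr
        _ = c⁻¹ * (‖(q • v.1 i).1 x‖ * w i ^ (N + N₀)) := by ring
        _ ≤ _ := by gcongr
  refine ⟨LinearMap.toSpanSingleton _ _ ⟨f, hf⟩, fun q hq => ?_⟩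
  rw [LinearMap.toSpanSingleton_apply]
  apply Subtype.ext
  funext i
  change q • f i = _
  simp only [f]
  rw [poly_smul_csmul]
  have h1 : q • v = p • φ ⟨q, hq⟩ := by
    rw [← map_smul, ← map_smul]
    congr 1
    apply Subtype.ext
    exact mul_comm _ _
  have h2 : q • v.1 i = p • (φ ⟨q, hq⟩).1 i := by
    have := congrArg (fun z : W K 0 τ w => z.1 i) h1
    exact this
  rw [h2, hfr, smul_smul, inv_mul_cancel₀ (hne i), one_smul]

end WSpace

end

noncomputable section
open MvPolynomial
open scoped ContDiff

/-! ## Choice of frequencies -/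

section Theta

open MeasureTheory in
theorem exists_avoid {Z L : Type} [Countable Z] [Countable L] (s : L → ℝ) (hs : Summable s)
    (hpos : ∀ l, 0 < s l) (d : Z → ℕ) (r : Z → L → Finset ℝ) (hr : ∀ z l, (r z l).card ≤ d z) :
    ∃ θ ∈ Set.Icc (0 : ℝ) 1, ∀ z, ∃ ε : ℝ, 0 < ε ∧ ∀ l, ∀ ρ ∈ r z l, ε * s l ≤ |θ - ρ| := by
  obtain ⟨ε', hε', hsum⟩ := ENNReal.exists_pos_sum_of_countable (ε := 1) one_ne_zero Z
  set S : ℝ := ∑' l, s l with hS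
  have hS0 : 0 ≤ S := tsum_nonneg fun l => (hpos l).le
  let ε : Z → ℝ := fun z => ε' z / (2 * d z * S + 1)
  have hε : ∀ z, 0 < ε z := fun z => by
    have : (0 : ℝ) < ε' z := hε' z
    simp only [ε]
    positivity
  let bad : Z → L → Set ℝ := fun z l => ⋃ ρ ∈ r z l, Metric.ball ρ (ε z * s l)
  have h1 : ∀ z l, volume (bad z l) ≤ ENNReal.ofReal (2 * d z * ε z * s l) := by
    intro z l
    refine (measure_biUnion_finset_le _ _).trans ?_
    simp only [Real.volume_ball, Finset.sum_const, nsmul_eq_mul]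
    have h0 : 0 ≤ 2 * (ε z * s l) := by have := hε z; have := hpos l; positivity
    calc ((r z l).card : ENNReal) * ENNReal.ofReal (2 * (ε z * s l))
        ≤ (d z : ENNReal) * ENNReal.ofReal (2 * (ε z * s l)) := by
          gcongr
          exact hr z l
      _ = ENNReal.ofReal (d z) * ENNReal.ofReal (2 * (ε z * s l)) := by
          rw [ENNReal.ofReal_natCast]
      _ = _ := by
          rw [← ENNReal.ofReal_mul (by positivity)]
          congr 1; ring
  have h2 : ∀ z, volume (⋃ l, bad z l) ≤ ε' z := by
    intro z
    refine (measure_iUnion_le _).trans ?_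
    refine (ENNReal.tsum_le_tsum (h1 z)).trans ?_
    rw [← ENNReal.ofReal_tsum_of_nonneg]
    · rw [tsum_mul_left, ← hS]
      have : 2 * d z * ε z * S ≤ ε' z := by
        simp only [ε]
        have h0 : (0 : ℝ) ≤ ε' z := (ε' z).2
        have h3 : 0 < 2 * d z * S + 1 := by positivity
        rw [show 2 * (d z : ℝ) * (ε' z / (2 * d z * S + 1)) * S =
          (2 * d z * S * ε' z) / (2 * d z * S + 1) by ring, div_le_iff₀ h3]
        nlinarith
      refine (ENNReal.ofReal_le_ofReal this).trans ?_
      rw [ENNReal.ofReal_coe_nnreal]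
    · intro l; have := hε z; have := hpos l; positivity
    · exact hs.mul_left _
  have h3 : volume (⋃ z, ⋃ l, bad z l) < 1 :=
    ((measure_iUnion_le _).trans (ENNReal.tsum_le_tsum h2)).trans_lt hsum
  have h4 : ¬ Set.Icc (0 : ℝ) 1 ⊆ ⋃ z, ⋃ l, bad z l := by
    intro h
    have := measure_mono (μ := volume) h
    rw [Real.volume_Icc] at this
    simp only [sub_zero, ENNReal.ofReal_one] at this
    exact absurd h3 (not_lt.2 this)
  obtain ⟨θ, hθ, hθ'⟩ := Set.not_subset.1 h4
  refine ⟨θ, hθ, fun z => ⟨ε z, hε z, fun l ρ hρ => ?_⟩⟩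
  by_contra hlt
  apply hθ'
  refine Set.mem_iUnion.2 ⟨z, Set.mem_iUnion.2 ⟨l, ?_⟩⟩
  refine Set.mem_biUnion hρ ?_
  rw [Metric.mem_ball, Real.dist_eq]
  exact not_le.1 hlt

theorem summable_int_sq : Summable fun k : ℤ => ((1 + |(k : ℝ)|) ^ 2)⁻¹ := by
  have h0 : Summable fun k : ℕ => ((1 + |((k : ℤ) : ℝ)|) ^ 2)⁻¹ := by
    have := (summable_nat_add_iff 1).2 (Real.summable_nat_pow_inv (p := 2) |>.2 (by norm_num))
    refine this.congr fun k => ?_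
    simp [add_comm]
  refine Summable.of_nat_of_neg h0 ?_
  refine h0.congr fun k => ?_
  simp

variable {n : ℕ} {K : Type} [CommRing K] [Algebra K ℂ]

/-- frequencies after adding the variable `x_j` -/
def tau' {I : Type} (τ : I → Fin n → ℂ) (j : Fin n) (T θ : ℝ) : I × ℤ × ℤ → Fin n → ℂ :=
  fun l => Function.update (τ l.1) j
    ((l.2.2 : ℂ) + θ + 2 * Real.pi * Complex.I * l.2.1 / T)

def wt' {I : Type} (w : I → ℝ) : I × ℤ × ℤ → ℝ :=
  fun l => w l.1 * ((1 + |(l.2.1 : ℝ)|) * (1 + |(l.2.2 : ℝ)|))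

theorem prod_lower (P : Polynomial ℂ) (z : ℂ) (η : ℝ) (hη : 0 ≤ η)
    (h : ∀ r ∈ P.roots, η ≤ ‖z - r‖) :
    ‖P.leadingCoeff‖ * η ^ P.natDegree ≤ ‖P.eval z‖ := by
  have hs := IsAlgClosed.splits P
  have h1 : P.eval z = P.leadingCoeff * (P.roots.map fun r => z - r).prod := by
    conv_lhs => rw [hs.eq_prod_roots]
    rw [Polynomial.eval_mul, Polynomial.eval_C, Polynomial.eval_multiset_prod, Multiset.map_map]
    simp
  rw [h1, norm_mul]
  gcongr
  rw [hs.natDegree_eq_card_roots]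
  clear h1
  generalize P.roots = t at h
  clear hs
  induction t using Multiset.induction_on with
  | empty => simp
  | cons a s ih =>
    rw [Multiset.card_cons, Multiset.map_cons, Multiset.prod_cons, norm_mul, pow_succ, mul_comm]
    gcongr
    · exact h a (by simp)
    · exact ih fun r hr => h r (by simp [hr])

theorem exists_theta [IsDomain K] [Countable K] {I : Type} (τ : I → Fin n → ℂ) (w : I → ℝ)
    (j : Fin n) (T : ℝ) (hg : Good K (j.val + 1) τ w) :
    ∃ θ ∈ Set.Icc (0 : ℝ) 1, Good K j.val (tau' τ j T θ) (wt' w) := by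
  obtain ⟨M₀, hM₀⟩ := hg.summ
  have hw0 : ∀ i, 0 < w i := fun i => zero_lt_one.trans_le (hg.one_le i)
  have hcI : Countable I := by
    have := hM₀.countable_support
    have h2 : (Function.support fun i => (w i ^ M₀)⁻¹) = Set.univ := by
      ext i
      have := hw0 i
      simp [this.ne']
    rw [h2] at this
    exact Set.countable_univ_iff.1 this
  have hw1 : ∀ l, 1 ≤ wt' w l := by
    intro l
    unfold wt'
    have h1 := hg.one_le l.1
    have h2 : 1 ≤ 1 + |(l.2.1 : ℝ)| := by have := abs_nonneg (l.2.1 : ℝ); linarith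
    have h3 : 1 ≤ 1 + |(l.2.2 : ℝ)| := by have := abs_nonneg (l.2.2 : ℝ); linarith
    exact one_le_mul_of_one_le_of_one_le h1 (one_le_mul_of_one_le_of_one_le h2 h3)
  have hw0' : ∀ l, 0 < wt' w l := fun l => zero_lt_one.trans_le (hw1 l)
  have hsum : Summable fun l => (wt' w l ^ (M₀ + 2))⁻¹ := by
    have h1 : Summable fun i => (w i ^ (M₀ + 2))⁻¹ := by
      refine Summable.of_nonneg_of_le (fun i => by have := hw0 i; positivity) (fun i => ?_) hM₀
      have := hw0 i
      gcongr
      · exact hg.one_le i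
      · omega
    have h2 : Summable fun k : ℤ => ((1 + |(k : ℝ)|) ^ (M₀ + 2))⁻¹ := by
      refine Summable.of_nonneg_of_le (fun i => by positivity) (fun i => ?_) summable_int_sq
      gcongr
      · have := abs_nonneg (i : ℝ); linarith
      · omega
    have h3 := h2.mul_of_nonneg h2 (fun k => by positivity) (fun k => by positivity)
    have h4 := h1.mul_of_nonneg h3 (fun i => by have := hw0 i; positivity) (fun k => by positivity)
    refine h4.congr fun l => ?_
    simp only [wt', mul_pow, mul_inv]
  let S : Set (Fin n) := {m | j.val + 1 ≤ m.val}
  let Z := {q : Polynomial (supported K S) // q ≠ 0}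
  have hcA : Countable (MvPolynomial (Fin n) K) := by
    refine Function.Injective.countable
      (f := fun q : MvPolynomial (Fin n) K => AddMonoidAlgebra.coeff q) ?_
    intro a b hab
    exact AddMonoidAlgebra.ext hab
  have hcB : Countable (supported K S) := Subtype.countable
  have hcP : Countable (Polynomial (supported K S)) := by
    refine Function.Injective.countable (f := fun q : Polynomial (supported K S) => q.toFinsupp.coeff) ?_
    intro a b hab
    exact Polynomial.toFinsupp_injective (AddMonoidAlgebra.ext hab)
  have hcZ : Countable Z := Subtype.countable
  let ψ : I → (supported K S →+* ℂ) := fun i =>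
    (aeval (τ i) : MvPolynomial (Fin n) K →ₐ[K] ℂ).toRingHom.comp (supported K S).val.toRingHom
  have hψ : ∀ i b, ψ i b = aeval (τ i) (b : MvPolynomial (Fin n) K) := fun i b => rfl
  classical
  let r : Z → I × ℤ × ℤ → Finset ℝ := fun q l =>
    ((q.1.map (ψ l.1)).roots.map fun z : ℂ => z.re - l.2.2).toFinset
  obtain ⟨θ, hθ, hgood⟩ := exists_avoid (Z := Z) (fun l => (wt' w l ^ (M₀ + 2))⁻¹) hsum
    (fun l => by have := hw0' l; positivity) (fun q => q.1.natDegree) r (by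
      intro q l
      refine (Multiset.toFinset_card_le _).trans ?_
      rw [Multiset.card_map]
      exact (Polynomial.card_roots' _).trans Polynomial.natDegree_map_le)
  refine ⟨θ, hθ, hw1, ⟨_, hsum⟩, fun p hp hp0 => ?_⟩
  have hins : {m : Fin n | j.val ≤ m.val} = insert j S := by
    ext m
    simp only [Set.mem_ofPred_eq, Set.mem_insert_iff, S, Fin.ext_iff]
    omega
  rw [hins] at hp
  obtain ⟨q, hq⟩ := exists_aeval_supported S j p hp
  have hq0 : q ≠ 0 := by rintro rfl; simp at hq; exact hp0 hq.symm
  obtain ⟨ε, hε, hav⟩ := hgood ⟨q, hq0⟩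
  have hb0 : (q.leadingCoeff : MvPolynomial (Fin n) K) ≠ 0 := by
    have := Polynomial.leadingCoeff_ne_zero.2 hq0
    exact fun h => this (Subtype.ext h)
  obtain ⟨c, hc, N₁, hlow⟩ := hg.low q.leadingCoeff q.leadingCoeff.2 hb0
  have hbi : ∀ i, ψ i q.leadingCoeff ≠ 0 := by
    intro i h0
    have := hlow i
    rw [← hψ, h0, norm_zero, zero_mul] at this
    linarith
  -- evaluation
  have heval : ∀ l, aeval (tau' τ j T θ l) p =
      (q.map (ψ l.1)).eval ((l.2.2 : ℂ) + θ + 2 * Real.pi * Complex.I * l.2.1 / T) := by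
    intro l
    rw [← hq, Polynomial.aeval_eq_sum_range, map_sum, Polynomial.eval_map, Polynomial.eval₂_eq_sum_range]
    refine Finset.sum_congr rfl fun r _ => ?_
    rw [Subalgebra.smul_def, smul_eq_mul, map_mul, map_pow, aeval_X, hψ]
    congr 1
    · have hb := (q.coeff r).2
      refine eval₂Hom_congr' rfl (fun m hm _ => ?_) rfl
      have : m ∈ S := by
        rw [mem_supported] at hb
        exact hb hm
      unfold tau'
      rw [Function.update_of_ne]
      rintro rfl
      simp [S] at this
    · simp [tau']
  refine ⟨c * ε ^ q.natDegree, by positivity, N₁ + (M₀ + 2) * q.natDegree, fun l => ?_⟩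
  rw [heval]
  set z := (l.2.2 : ℂ) + θ + 2 * Real.pi * Complex.I * l.2.1 / T with hz
  have hzre : z.re = l.2.2 + θ := by
    have : 2 * Real.pi * Complex.I * l.2.1 / T = ((2 * Real.pi * l.2.1 / T : ℝ) : ℂ) * Complex.I := by
      push_cast; ring
    rw [hz, this]
    simp
  have hwl := hw0' l
  have h1 := prod_lower (q.map (ψ l.1)) z (ε * (wt' w l ^ (M₀ + 2))⁻¹) (by positivity) (by
    intro ρ hρ
    have h2 := hav l (ρ.re - l.2.2) (by
      simp only [r, Multiset.mem_toFinset, Multiset.mem_map]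
      exact ⟨ρ, hρ, rfl⟩)
    refine h2.trans ?_
    refine le_trans (le_of_eq ?_) (Complex.abs_re_le_norm _)
    rw [Complex.sub_re, hzre]
    congr 1; ring)
  rw [Polynomial.leadingCoeff_map_of_leadingCoeff_ne_zero _ (hbi _),
    Polynomial.natDegree_map_of_leadingCoeff_ne_zero _ (hbi _), hψ] at h1
  have h3 := hlow l.1
  have hle : w l.1 ≤ wt' w l := by
    unfold wt'
    have h2 : 1 ≤ 1 + |(l.2.1 : ℝ)| := by have := abs_nonneg (l.2.1 : ℝ); linarith
    have h3 : 1 ≤ 1 + |(l.2.2 : ℝ)| := by have := abs_nonneg (l.2.2 : ℝ); linarith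
    exact le_mul_of_one_le_right (hw0 _).le (one_le_mul_of_one_le_of_one_le h2 h3)
  have h4 : c ≤ ‖aeval (τ l.1) (q.leadingCoeff : MvPolynomial (Fin n) K)‖ * wt' w l ^ N₁ := by
    refine h3.trans ?_
    have := hw0 l.1
    gcongr
  calc c * ε ^ q.natDegree
      ≤ (‖aeval (τ l.1) (q.leadingCoeff : MvPolynomial (Fin n) K)‖ * wt' w l ^ N₁)
          * ε ^ q.natDegree := by gcongr
    _ = (‖aeval (τ l.1) (q.leadingCoeff : MvPolynomial (Fin n) K)‖
          * (ε * (wt' w l ^ (M₀ + 2))⁻¹) ^ q.natDegree) * wt' w l ^ (N₁ + (M₀ + 2) * q.natDegree) := by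
        rw [mul_pow, inv_pow, ← pow_mul, pow_add]
        field_simp
    _ ≤ _ := by gcongr

end Theta

end

noncomputable section
set_option linter.unusedSectionVars false
open MvPolynomial
open scoped ContDiff

/-! ## Summation -/

section Tsum

variable {n : ℕ} {K : Type} [CommRing K] [Algebra K ℂ] [Module (MvPolynomial (Fin n) K) (Cinf n)]
  [DMod n K]

variable (K) in
/-- locally uniform summability of all derivatives -/
def Bdd {κ : Type} (g : κ → Cinf n) : Prop :=
  ∀ (p : MvPolynomial (Fin n) K) (R : ℝ), ∃ b : κ → ℝ, Summable b ∧
    ∀ k x, (∀ m, |x m| ≤ R) → ‖(p • g k).1 x‖ ≤ b k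

theorem Bdd.smul {κ : Type} {g : κ → Cinf n} (h : Bdd K g) (p : MvPolynomial (Fin n) K) :
    Bdd K fun k => p • g k := by
  intro q R
  obtain ⟨b, hb, hb'⟩ := h (q * p) R
  refine ⟨b, hb, fun k x hx => ?_⟩
  rw [← mul_smul]
  exact hb' k x hx

theorem Bdd.summable {κ : Type} {g : κ → Cinf n} (h : Bdd K g) (x : Fin n → ℝ) :
    Summable fun k => (g k).1 x := by
  obtain ⟨b, hb, hb'⟩ := h 1 ‖x‖
  refine Summable.of_norm_bounded hb fun k => ?_
  have := hb' k x fun m => by simpa using norm_le_pi_norm x m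
  rwa [one_smul] at this

theorem hasSum_gradCLM {κ : Type} (a : κ → Fin n → ℂ) (h : ∀ m, Summable fun k => a k m) :
    HasSum (fun k => gradCLM (a k)) (gradCLM fun m => ∑' k, a k m) := by
  unfold gradCLM
  refine hasSum_sum fun m _ => ?_
  exact (h m).hasSum.mapL (ContinuousLinearMap.smulRightL ℝ (Fin n → ℝ) ℂ
    (ContinuousLinearMap.proj (R := ℝ) (φ := fun _ : Fin n => ℝ) m))

theorem Bdd.hasFDerivAt {κ : Type} {g : κ → Cinf n} (h : Bdd K g) (x : Fin n → ℝ) :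
    HasFDerivAt (fun y => ∑' k, (g k).1 y)
      (gradCLM fun m => ∑' k, ((X m : MvPolynomial (Fin n) K) • g k).1 x) x := by
  choose b hb hb' using fun m : Fin n => h (X m) (‖x‖ + 1)
  have hx : x ∈ Metric.ball (0 : Fin n → ℝ) (‖x‖ + 1) := by simp
  have key := hasFDerivAt_tsum_of_isPreconnected (𝕜 := ℝ) (f := fun k => (g k).1)
    (f' := fun k y => gradCLM fun m => ((X m : MvPolynomial (Fin n) K) • g k).1 y)
    (u := fun k => ∑ m, b m k) (s := Metric.ball (0 : Fin n → ℝ) (‖x‖ + 1)) (x₀ := x) (x := x)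
    (summable_sum fun m _ => hb m) Metric.isOpen_ball (convex_ball _ _).isPreconnected
    (fun k y _ => hasFDerivAt_C K (g k) y)
    (fun k y hy => by
      refine (gradCLM_norm_le _).trans (Finset.sum_le_sum fun m _ => hb' m k y fun i => ?_)
      have h1 : ‖y‖ < ‖x‖ + 1 := by simpa using hy
      have h2 := norm_le_pi_norm y i
      rw [Real.norm_eq_abs] at h2
      linarith) hx (h.summable x) hx
  rw [(hasSum_gradCLM _ fun m => (h.smul (X m)).summable x).tsum_eq] at key
  exact key

/-- the sum of a locally uniformly summable family -/
def csum {κ : Type} (g : κ → Cinf n) (h : Bdd K g) : Cinf n :=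
  ⟨fun x => ∑' k, (g k).1 x, by
    change ContDiff ℝ ∞ _
    refine smooth_of_closed {f | ∃ p : MvPolynomial (Fin n) K, f = fun x => ∑' k, (p • g k).1 x}
      ?_ _ ⟨1, by simp⟩
    rintro f ⟨p, rfl⟩
    refine ⟨fun m x => ∑' k, ((X m * p : MvPolynomial (Fin n) K) • g k).1 x,
      fun m => ⟨X m * p, rfl⟩, fun x => ?_⟩
    simp only [mul_smul]
    exact (h.smul p).hasFDerivAt x⟩

theorem csum_apply {κ : Type} (g : κ → Cinf n) (h : Bdd K g) (x : Fin n → ℝ) :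
    (csum g h).1 x = ∑' k, (g k).1 x := rfl

theorem smul_csum {κ : Type} (p : MvPolynomial (Fin n) K) (g : κ → Cinf n) (h : Bdd K g) :
    p • csum g h = csum (fun k => p • g k) (h.smul p) := by
  induction p using MvPolynomial.induction_on generalizing g with
  | C c =>
    apply Subtype.ext; funext x
    rw [C_smul_apply, csum_apply, csum_apply, ← tsum_mul_left]
    simp only [C_smul_apply]
  | add p q hp hq =>
    rw [add_smul, hp, hq]
    apply Subtype.ext; funext x
    rw [add_apply', csum_apply, csum_apply, csum_apply,
      ← ((h.smul p).summable x).tsum_add ((h.smul q).summable x)]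
    simp only [add_smul, add_apply']
  | mul_X p i hp =>
    rw [mul_smul]
    have : (X i : MvPolynomial (Fin n) K) • csum g h = csum (fun k => X i • g k) (h.smul (X i)) := by
      apply Subtype.ext; funext x
      rw [X_smul_of_hasFDerivAt K (csum g h) x _ (h.hasFDerivAt x) i, csum_apply]
    rw [this, hp]
    apply Subtype.ext; funext x
    rw [csum_apply, csum_apply]
    simp only [mul_smul]

theorem smul_csum_apply {κ : Type} (p : MvPolynomial (Fin n) K) (g : κ → Cinf n) (h : Bdd K g)
    (x : Fin n → ℝ) : (p • csum g h).1 x = ∑' k, (p • g k).1 x := by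
  rw [smul_csum, csum_apply]

end Tsum

section Synth

variable {n : ℕ} {K : Type} [CommRing K] [Algebra K ℂ] [Module (MvPolynomial (Fin n) K) (Cinf n)]
  [DMod n K]

variable {I : Type} {τ : I → Fin n → ℂ} {w : I → ℝ} {j : Fin n} {T θ : ℝ}

theorem sum_split (j : Fin n) (f : Fin n → ℂ) :
    (∑ m : Fin n, if j.val ≤ m.val then f m else 0) =
      f j + ∑ m : Fin n, if j.val + 1 ≤ m.val then f m else 0 := by
  have : f j = ∑ m : Fin n, if m = j then f m else 0 := by simp
  rw [this, ← Finset.sum_add_distrib]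
  refine Finset.sum_congr rfl fun m _ => ?_
  by_cases h : m = j
  · subst h; simp
  · have : m.val ≠ j.val := fun h' => h (Fin.ext h')
    by_cases h2 : j.val ≤ m.val
    · have : j.val + 1 ≤ m.val := by omega
      simp [h, h2, this]
    · have : ¬ j.val + 1 ≤ m.val := by omega
      simp [h, h2, this]

theorem tau_re (l : I × ℤ × ℤ) : (tau' τ j T θ l j).re = l.2.2 + θ := by
  have : 2 * Real.pi * Complex.I * l.2.1 / T = ((2 * Real.pi * l.2.1 / T : ℝ) : ℂ) * Complex.I := by
    push_cast; ring
  simp [tau', this]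

theorem tau_of_gt (l : I × ℤ × ℤ) (m : Fin n) (hm : j.val + 1 ≤ m.val) :
    tau' τ j T θ l m = τ l.1 m := by
  unfold tau'
  rw [Function.update_of_ne]
  rintro rfl
  omega

theorem W_norm (u : W K j.val (tau' τ j T θ) (wt' w)) (p : MvPolynomial (Fin n) K)
    (l : I × ℤ × ℤ) (x : Fin n → ℝ) : ‖(p • u.1 l).1 x‖ =
      Real.exp ((l.2.2 + θ) * x j +
        (∑ m : Fin n, if j.val + 1 ≤ m.val then τ l.1 m * x m else 0).re) *
        ‖(p • u.1 l).1 (projj j.val x)‖ := by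
  have h := freq_formula (K := K) j.val (tau' τ j T θ l) (p • u.1 l)
    (fun m hm => (p • u).2.1 l m hm) x
  rw [h, norm_mul, Complex.norm_exp]
  congr 2
  rw [sum_split, Complex.add_re]
  congr 1
  · rw [Complex.re_mul_ofReal, tau_re]
  · congr 1
    refine Finset.sum_congr rfl fun m _ => ?_
    split_ifs with hm
    · rw [tau_of_gt l m hm]
    · rfl

theorem W_slice_bound (hw : ∀ i, 1 ≤ w i) (u : W K j.val (tau' τ j T θ) (wt' w))
    (p : MvPolynomial (Fin n) K) (N : ℕ) (R : ℝ) :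
    ∃ C : ℝ, 0 ≤ C ∧ ∀ l, ∀ x ∈ slice n j.val R,
      ‖(p • u.1 l).1 x‖ * |w l.1| ^ N ≤ C * ((1 + |(l.2.1 : ℝ)|) ^ 2)⁻¹ := by
  obtain ⟨C, hC⟩ := u.2.2 p (N + 2) R
  refine ⟨max C 0, le_max_right _ _, fun l x hx => ?_⟩
  have h1 := (hC l x hx).trans (le_max_left C 0)
  have hk : 0 < 1 + |(l.2.1 : ℝ)| := by positivity
  rw [← div_eq_mul_inv, le_div_iff₀ (by positivity)]
  refine le_trans ?_ h1
  have hwl := hw l.1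
  have hw0 : 0 < w l.1 := by linarith
  have h2 : 1 ≤ 1 + |(l.2.1 : ℝ)| := by have := abs_nonneg (l.2.1 : ℝ); linarith
  have h3 : 1 ≤ 1 + |(l.2.2 : ℝ)| := by have := abs_nonneg (l.2.2 : ℝ); linarith
  have hpos : 0 < wt' w l := by unfold wt'; positivity
  have h4 : w l.1 ≤ wt' w l := by
    unfold wt'
    exact le_mul_of_one_le_right hw0.le (one_le_mul_of_one_le_of_one_le h2 h3)
  have h5 : 1 + |(l.2.1 : ℝ)| ≤ wt' w l := by
    unfold wt'
    calc 1 + |(l.2.1 : ℝ)| = 1 * ((1 + |(l.2.1 : ℝ)|) * 1) := by ring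
      _ ≤ _ := by gcongr
  rw [abs_of_pos hw0, abs_of_pos hpos, pow_add, mul_assoc]
  gcongr

theorem synth_bdd (hw : ∀ i, 1 ≤ w i) (u : W K j.val (tau' τ j T θ) (wt' w)) (lam : ℤ) (i : I) :
    Bdd K fun k : ℤ => u.1 (i, k, lam) := by
  intro p R
  obtain ⟨C, hC0, hC⟩ := W_slice_bound hw u p 0 |R|
  let D : ℝ := Real.exp (|(lam + θ)| * |R| + ∑ m : Fin n, ‖τ i m‖ * |R|)
  refine ⟨fun k => D * (C * ((1 + |(k : ℝ)|) ^ 2)⁻¹), (summable_int_sq.mul_left C).mul_left D,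
    fun k x hx => ?_⟩
  rw [W_norm]
  have hx' : ∀ m, |x m| ≤ |R| := fun m => (hx m).trans (le_abs_self _)
  have h1 := hC (i, k, lam) _ (projj_mem j.val x |R| hx')
  rw [pow_zero, mul_one] at h1
  have h2 : Real.exp ((lam + θ) * x j +
        (∑ m : Fin n, if j.val + 1 ≤ m.val then τ i m * x m else 0).re) ≤ D := by
    apply Real.exp_le_exp.2
    have h3 : (lam + θ) * x j ≤ |(lam + θ)| * |R| := by
      refine (le_abs_self _).trans ?_
      rw [abs_mul]
      exact mul_le_mul_of_nonneg_left (hx' j) (abs_nonneg _)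
    have h4 : (∑ m : Fin n, if j.val + 1 ≤ m.val then τ i m * x m else 0).re ≤
        ∑ m : Fin n, ‖τ i m‖ * |R| := by
      refine (Complex.re_le_norm _).trans ((norm_sum_le _ _).trans (Finset.sum_le_sum fun m _ => ?_))
      split_ifs
      · rw [norm_mul, Complex.norm_real, Real.norm_eq_abs]
        exact mul_le_mul_of_nonneg_left (hx' m) (norm_nonneg _)
      · rw [norm_zero]; positivity
    linarith
  exact mul_le_mul h2 h1 (norm_nonneg _) (by positivity)

theorem synth_bound (hw : ∀ i, 1 ≤ w i) (u : W K j.val (tau' τ j T θ) (wt' w))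
    (p : MvPolynomial (Fin n) K) (N : ℕ) (R : ℝ) : ∃ C : ℝ, 0 ≤ C ∧ ∀ (lam : ℤ) (i : I),
      ∀ x ∈ slice n (j.val + 1) R,
        ‖(p • csum _ (synth_bdd hw u lam i)).1 x‖ * |w i| ^ N ≤ C * Real.exp ((lam + θ) * x j) := by
  obtain ⟨C, hC0, hC⟩ := W_slice_bound hw u p N R
  let S : ℝ := ∑' k : ℤ, ((1 + |(k : ℝ)|) ^ 2)⁻¹
  have hS : 0 ≤ S := tsum_nonneg fun k => by positivity
  refine ⟨C * S, by positivity, fun lam i x hx => ?_⟩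
  rw [smul_csum_apply]
  have hz : (∑ m : Fin n, if j.val + 1 ≤ m.val then τ i m * x m else 0) = 0 := by
    refine Finset.sum_eq_zero fun m _ => ?_
    split_ifs with hm
    · rw [(hx m).2 hm]; simp
    · rfl
  have h1 : ∀ k : ℤ, ‖(p • u.1 (i, k, lam)).1 x‖ * |w i| ^ N ≤
      Real.exp ((lam + θ) * x j) * C * ((1 + |(k : ℝ)|) ^ 2)⁻¹ := by
    intro k
    rw [W_norm, hz, Complex.zero_re, add_zero, mul_assoc, mul_assoc]
    have := hC (i, k, lam) _ (projj_mem j.val x R fun m => (hx m).1)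
    gcongr
  have hsum : Summable fun k : ℤ => Real.exp ((lam + θ) * x j) * C * ((1 + |(k : ℝ)|) ^ 2)⁻¹ :=
    summable_int_sq.mul_left _
  have hw0 : 0 < |w i| ^ N := by
    have := hw i
    have : 0 < w i := by linarith
    positivity
  have h2 : ‖∑' k : ℤ, (p • u.1 (i, k, lam)).1 x‖ ≤
      ∑' k : ℤ, Real.exp ((lam + θ) * x j) * C * ((1 + |(k : ℝ)|) ^ 2)⁻¹ / |w i| ^ N := by
    refine tsum_of_norm_bounded (hsum.div_const _).hasSum fun k => ?_
    rw [le_div_iff₀ hw0]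
    exact h1 k
  rw [tsum_div_const, le_div_iff₀ hw0, tsum_mul_left] at h2
  refine h2.trans (le_of_eq ?_)
  ring

/-- summation over `k` -/
def synth (hw : ∀ i, 1 ≤ w i) (lam : ℤ) :
    W K j.val (tau' τ j T θ) (wt' w) →ₗ[MvPolynomial (Fin n) K] W K (j.val + 1) τ w where
  toFun u := ⟨fun i => csum _ (synth_bdd hw u lam i), by
    refine ⟨fun i m hm => ?_, fun p N R => ?_⟩
    · apply Subtype.ext; funext x
      rw [smul_csum_apply, csmul_apply', csum_apply, ← tsum_mul_left]
      refine tsum_congr fun k => ?_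
      rw [u.2.1 _ m (by omega), tau_of_gt _ m hm, csmul_apply']
    · obtain ⟨C, hC0, hC⟩ := synth_bound hw u p N R
      refine ⟨C * Real.exp (|(lam + θ)| * R), fun i x hx => (hC lam i x hx).trans ?_⟩
      have : (lam + θ) * x j ≤ |(lam + θ)| * R := by
        refine (le_abs_self _).trans ?_
        rw [abs_mul]
        gcongr
        exact (hx j).1
      gcongr⟩
  map_add' u v := by
    apply Subtype.ext; funext i; apply Subtype.ext; funext x
    change (csum _ (synth_bdd hw (u + v) lam i)).1 x =
      (csum _ (synth_bdd hw u lam i)).1 x + (csum _ (synth_bdd hw v lam i)).1 x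
    rw [csum_apply, csum_apply, csum_apply,
      ← ((synth_bdd hw u lam i).summable x).tsum_add ((synth_bdd hw v lam i).summable x)]
    rfl
  map_smul' p u := by
    apply Subtype.ext; funext i; apply Subtype.ext; funext x
    change (csum _ (synth_bdd hw (p • u) lam i)).1 x = (p • csum _ (synth_bdd hw u lam i)).1 x
    rw [smul_csum_apply, csum_apply]
    rfl

theorem synth_apply (hw : ∀ i, 1 ≤ w i) (lam : ℤ) (u : W K j.val (tau' τ j T θ) (wt' w)) (i : I)
    (x : Fin n → ℝ) : ((synth hw lam u).1 i).1 x = ∑' k : ℤ, (u.1 (i, k, lam)).1 x := rfl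

theorem synth_bound' (hw : ∀ i, 1 ≤ w i) (u : W K j.val (tau' τ j T θ) (wt' w))
    (p : MvPolynomial (Fin n) K) (N : ℕ) (R : ℝ) : ∃ C : ℝ, 0 ≤ C ∧ ∀ (lam : ℤ) (i : I),
      ∀ x ∈ slice n (j.val + 1) R,
        ‖(p • (synth hw lam u).1 i).1 x‖ * |w i| ^ N ≤ C * Real.exp ((lam + θ) * x j) :=
  synth_bound hw u p N R

end Synth

end

noncomputable section
set_option linter.unusedSectionVars false
open MvPolynomial
open scoped ContDiff

/-! ## Fourier coefficients in the variable `x_j` -/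

section Fint

variable {n : ℕ} (K : Type) [CommRing K] [Algebra K ℂ] [Module (MvPolynomial (Fin n) K) (Cinf n)]
  [DMod n K]

theorem continuous_upd (j : Fin n) (f : Cinf n) :
    Continuous fun q : (Fin n → ℝ) × ℝ => f.1 (Function.update q.1 j q.2) :=
  (Cinf.continuous f).comp (continuous_fst.update j continuous_snd)

theorem hasFDerivAt_upd (j : Fin n) (f : Cinf n) (s : ℝ) (x : Fin n → ℝ) :
    HasFDerivAt (fun y => f.1 (Function.update y j s))
      (gradCLM fun m => if m = j then 0 else
        ((X m : MvPolynomial (Fin n) K) • f).1 (Function.update x j s)) x := by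
  let L : (Fin n → ℝ) →L[ℝ] (Fin n → ℝ) := ContinuousLinearMap.pi fun m =>
    if m = j then 0 else ContinuousLinearMap.proj m
  have h1 : HasFDerivAt (fun y : Fin n → ℝ => Function.update y j s) L x := by
    rw [hasFDerivAt_pi']
    intro m
    by_cases hm : m = j
    · subst hm
      simp only [Function.update_self]
      have h3 : (ContinuousLinearMap.proj m).comp L = (0 : (Fin n → ℝ) →L[ℝ] ℝ) := by
        ext v; simp [L]
      rw [h3]
      exact hasFDerivAt_const s x
    · simp only [Function.update_of_ne hm]
      have h2 := (ContinuousLinearMap.proj (R := ℝ) (φ := fun _ : Fin n => ℝ) m).hasFDerivAt (x := x)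
      have h3 : (ContinuousLinearMap.proj m).comp L =
          ContinuousLinearMap.proj (R := ℝ) (φ := fun _ : Fin n => ℝ) m := by
        ext v; simp [L, hm]
      rw [h3]
      exact h2
  have h2 := (hasFDerivAt_C K f (Function.update x j s)).comp x h1
  have h3 : (gradCLM fun m => ((X m : MvPolynomial (Fin n) K) • f).1 (Function.update x j s)).comp L =
      gradCLM fun m => if m = j then 0 else
        ((X m : MvPolynomial (Fin n) K) • f).1 (Function.update x j s) := by
    refine ContinuousLinearMap.ext fun v => ?_
    rw [ContinuousLinearMap.comp_apply, gradCLM_apply, gradCLM_apply]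
    refine Finset.sum_congr rfl fun m _ => ?_
    by_cases hm : m = j
    · simp [L, hm]
    · simp [L, hm]
  rw [← h3]
  exact h2

/-- integral against `ψ` in the variable `x_j` -/
def gfun (j : Fin n) (T : ℝ) (ψ : ℝ → ℂ) (f : Cinf n) (x : Fin n → ℝ) : ℂ :=
  ∫ s in (-(T / 2))..(T / 2), ψ s * f.1 (Function.update x j s)

theorem gfun_intble (j : Fin n) (T : ℝ) (ψ : ℝ → ℂ) (hψ : Continuous ψ) (f : Cinf n)
    (x : Fin n → ℝ) : IntervalIntegrable (fun s => ψ s * f.1 (Function.update x j s))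
      MeasureTheory.volume (-(T / 2)) (T / 2) :=
  (hψ.mul ((continuous_upd j f).comp (Continuous.prodMk_right x))).intervalIntegrable _ _

theorem gfun_hasFDerivAt (j : Fin n) (T : ℝ) (ψ : ℝ → ℂ) (hψ : Continuous ψ) (f : Cinf n)
    (x : Fin n → ℝ) : HasFDerivAt (gfun j T ψ f)
      (gradCLM fun m => gfun j T ψ (if m = j then 0 else (X m : MvPolynomial (Fin n) K) • f) x) x := by
  let F' : (Fin n → ℝ) → ℝ → ((Fin n → ℝ) →L[ℝ] ℂ) := fun y s =>
    ψ s • gradCLM fun m => if m = j then 0 else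
        ((X m : MvPolynomial (Fin n) K) • f).1 (Function.update y j s)
  have hF'c : Continuous fun q : (Fin n → ℝ) × ℝ => F' q.1 q.2 := by
    refine (hψ.comp continuous_snd).smul ?_
    unfold gradCLM
    refine continuous_finsetSum _ fun m _ => ?_
    by_cases hm : m = j
    · simp only [hm, if_true]
      exact continuous_const
    · simp only [hm, if_false]
      exact (ContinuousLinearMap.smulRightL ℝ (Fin n → ℝ) ℂ
        (ContinuousLinearMap.proj (R := ℝ) (φ := fun _ : Fin n => ℝ) m)).continuous.comp
          (continuous_upd j _)
  obtain ⟨B, hB⟩ := ((isCompact_closedBall x 1).prod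
    (isCompact_uIcc (a := -(T / 2)) (b := T / 2))).exists_bound_of_continuousOn hF'c.continuousOn
  have hcx : ∀ g : Cinf n, ∀ y, Continuous fun s => ψ s * g.1 (Function.update y j s) := fun g y =>
    hψ.mul ((continuous_upd j g).comp (Continuous.prodMk_right y))
  have key := (intervalIntegral.hasFDerivAt_integral_of_dominated_of_fderiv_le (𝕜 := ℝ)
    (F := fun y s => ψ s * f.1 (Function.update y j s)) (F' := F') (x₀ := x)
    (a := -(T / 2)) (b := T / 2) (μ := MeasureTheory.volume) (bound := fun _ => B)
    (s := Metric.closedBall x 1) (Metric.closedBall_mem_nhds x one_pos)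
    (Filter.Eventually.of_forall fun y => (hcx f y).aestronglyMeasurable)
    (gfun_intble j T ψ hψ f x)
    (hF'c.comp (Continuous.prodMk_right x)).aestronglyMeasurable
    (Filter.Eventually.of_forall fun s hs y hy => hB (y, s) ⟨hy, Set.uIoc_subset_uIcc hs⟩)
    intervalIntegrable_const
    (Filter.Eventually.of_forall fun s hs y hy => ((hasFDerivAt_upd K j f s y).const_mul (ψ s))))
  have h2 : (∫ s in (-(T / 2))..(T / 2), F' x s) =
      gradCLM fun m => gfun j T ψ (if m = j then 0 else (X m : MvPolynomial (Fin n) K) • f) x := by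
    have hi : IntervalIntegrable (F' x) MeasureTheory.volume (-(T / 2)) (T / 2) :=
      (hF'c.comp (Continuous.prodMk_right x)).intervalIntegrable _ _
    refine ContinuousLinearMap.ext fun v => ?_
    rw [ContinuousLinearMap.intervalIntegral_apply hi, gradCLM_apply]
    simp only [F', gfun]
    simp only [smul_apply, gradCLM_apply, smul_eq_mul, Finset.mul_sum]
    rw [intervalIntegral.integral_finsetSum]
    · refine Finset.sum_congr rfl fun m _ => ?_
      rw [← intervalIntegral.integral_const_mul]
      congr 1
      funext s
      by_cases hm : m = j
      · simp [hm, zero_apply']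
      · simp [hm]; ring
    · intro m _
      by_cases hm : m = j
      · simp [hm]
      · simp only [hm, if_false]
        have := (hcx ((X m : MvPolynomial (Fin n) K) • f) x).mul
          (continuous_const (y := ((v m : ℝ) : ℂ)))
        refine (this.intervalIntegrable _ _).congr ?_
        intro s _
        simp only [Pi.mul_apply]
        ring
  rw [h2] at key
  exact key

/-- `gfun` as a smooth function -/
def Gint (j : Fin n) (T : ℝ) (ψ : ℝ → ℂ) (hψ : Continuous ψ) (f : Cinf n) : Cinf n :=
  ⟨gfun j T ψ f, by
    change ContDiff ℝ ∞ _
    refine smooth_of_closed (Set.range (gfun j T ψ)) ?_ _ ⟨f, rfl⟩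
    rintro _ ⟨f, rfl⟩
    exact ⟨_, fun m => ⟨_, rfl⟩, fun x => gfun_hasFDerivAt K j T ψ hψ f x⟩⟩

theorem X_Gint (j : Fin n) (T : ℝ) (ψ : ℝ → ℂ) (hψ : Continuous ψ) (f : Cinf n) (m : Fin n) :
    (X m : MvPolynomial (Fin n) K) • Gint K j T ψ hψ f =
      Gint K j T ψ hψ (if m = j then 0 else (X m : MvPolynomial (Fin n) K) • f) := by
  apply Subtype.ext; funext x
  rw [X_smul_of_hasFDerivAt K _ x _ (gfun_hasFDerivAt K j T ψ hψ f x) m]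
  rfl

end Fint

end

noncomputable section
set_option linter.unusedSectionVars false
open MvPolynomial
open scoped ContDiff

section FMap

variable {n : ℕ} (K : Type) [CommRing K] [Algebra K ℂ] [Module (MvPolynomial (Fin n) K) (Cinf n)]
  [DMod n K]

/-- smooth functions supported in `[α, β]` -/
def Cut (α β : ℝ) : Type := {χ : ℝ → ℂ // ContDiff ℝ ∞ χ ∧ ∀ s, s ∉ Set.Icc α β → χ s = 0}

def Cut.der {α β : ℝ} (χ : Cut α β) : Cut α β :=
  ⟨deriv χ.1, (contDiff_infty_iff_deriv.1 χ.2.1).2, fun s hs => by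
    have : χ.1 =ᶠ[nhds s] fun _ => 0 := by
      filter_upwards [isClosed_Icc.isOpen_compl.mem_nhds hs] with y hy using χ.2.2 y hy
    rw [this.deriv_eq]; simp⟩

theorem Cut.hasDerivAt {α β : ℝ} (χ : Cut α β) (s : ℝ) : HasDerivAt χ.1 (χ.der.1 s) s :=
  ((contDiff_infty_iff_deriv.1 χ.2.1).1 s).hasDerivAt

theorem Cut.continuous {α β : ℝ} (χ : Cut α β) : Continuous χ.1 := χ.2.1.continuous

theorem Cut.bound {α β : ℝ} (χ : Cut α β) : ∃ D : ℝ, 0 ≤ D ∧ ∀ s, ‖χ.1 s‖ ≤ D := by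
  obtain ⟨D, hD⟩ := (isCompact_Icc (a := α) (b := β)).exists_bound_of_continuousOn
    χ.continuous.continuousOn
  refine ⟨max D 0, le_max_right _ _, fun s => ?_⟩
  by_cases hs : s ∈ Set.Icc α β
  · exact (hD s hs).trans (le_max_left _ _)
  · rw [χ.2.2 s hs, norm_zero]; exact le_max_right _ _

theorem contDiff_cexp_mul (τ : ℂ) : ContDiff ℝ ∞ fun t : ℝ => Complex.exp (τ * t) :=
  (contDiff_const.mul Complex.ofRealCLM.contDiff).cexp

theorem cont_psi {α β : ℝ} (χ : Cut α β) (τ : ℂ) :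
    Continuous fun s : ℝ => χ.1 s * Complex.exp (-(τ * s)) := by
  have := χ.continuous
  fun_prop

def Fint (j : Fin n) (T : ℝ) {α β : ℝ} (χ : Cut α β) (τ : ℂ) (f : Cinf n) : Cinf n :=
  mulT j (fun t => Complex.exp (τ * t)) (contDiff_cexp_mul τ)
    (Gint K j T (fun s => χ.1 s * Complex.exp (-(τ * s))) (cont_psi χ τ) f)

variable (j : Fin n) (T : ℝ) {α β : ℝ} (χ : Cut α β) (τ : ℂ)

theorem Fint_apply (f : Cinf n) (x : Fin n → ℝ) : (Fint K j T χ τ f).1 x =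
    Complex.exp (τ * x j) * ∫ s in (-(T / 2))..(T / 2),
      χ.1 s * Complex.exp (-(τ * s)) * f.1 (Function.update x j s) := rfl

theorem Fint_add (f g : Cinf n) : Fint K j T χ τ (f + g) = Fint K j T χ τ f + Fint K j T χ τ g := by
  apply Subtype.ext; funext x
  rw [add_apply', Fint_apply, Fint_apply, Fint_apply, ← mul_add, ← intervalIntegral.integral_add
    (gfun_intble j T _ (cont_psi χ τ) f x) (gfun_intble j T _ (cont_psi χ τ) g x)]
  simp only [add_apply', mul_add]

theorem Fint_csmul (c : ℂ) (f : Cinf n) : Fint K j T χ τ (c • f) = c • Fint K j T χ τ f := by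
  apply Subtype.ext; funext x
  rw [csmul_apply', Fint_apply, Fint_apply, mul_left_comm c]
  congr 1
  rw [← intervalIntegral.integral_const_mul]
  congr 1; funext s
  rw [csmul_apply']; ring

theorem X_Fint_ne (f : Cinf n) (m : Fin n) (hm : m ≠ j) :
    (X m : MvPolynomial (Fin n) K) • Fint K j T χ τ f = Fint K j T χ τ ((X m : MvPolynomial (Fin n) K) • f) := by
  unfold Fint
  rw [X_mulT, X_Gint]
  simp [hm]

theorem X_Fint (f : Cinf n) :
    (X j : MvPolynomial (Fin n) K) • Fint K j T χ τ f = τ • Fint K j T χ τ f := by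
  unfold Fint
  rw [X_mulT, X_Gint]
  simp only [if_true]
  apply Subtype.ext; funext x
  rw [add_apply', csmul_apply', mulT_apply, mulT_apply, mulT_apply]
  have h1 : (Gint K j T (fun s => χ.1 s * Complex.exp (-(τ * s))) (cont_psi χ τ) 0).1 x = 0 := by
    change gfun j T _ 0 x = 0
    simp [gfun, zero_apply']
  have h2 : deriv (fun t : ℝ => Complex.exp (τ * t)) (x j) = τ * Complex.exp (τ * x j) := by
    have := ((Complex.ofRealCLM.hasDerivAt (x := x j)).const_mul τ).cexp
    simp only [Complex.ofRealCLM_apply] at this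
    rw [this.deriv]; simp; ring
  rw [h1, h2]; ring

theorem Fint_parts (hα : -(T / 2) < α) (hβ : β < T / 2) (f : Cinf n) :
    τ • Fint K j T χ τ f = Fint K j T χ.der τ f +
      Fint K j T χ τ ((X j : MvPolynomial (Fin n) K) • f) := by
  apply Subtype.ext; funext x
  rw [add_apply', csmul_apply', Fint_apply, Fint_apply, Fint_apply, ← mul_add, mul_left_comm]
  congr 1
  let g : ℝ → ℂ := fun s => χ.1 s * Complex.exp (-(τ * s)) * f.1 (Function.update x j s)
  let g1 : ℝ → ℂ := fun s => χ.der.1 s * Complex.exp (-(τ * s)) * f.1 (Function.update x j s)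
  let g2 : ℝ → ℂ := fun s => χ.1 s * Complex.exp (-(τ * s)) *
    ((X j : MvPolynomial (Fin n) K) • f).1 (Function.update x j s)
  have i0 : IntervalIntegrable g MeasureTheory.volume (-(T / 2)) (T / 2) :=
    gfun_intble j T _ (cont_psi χ τ) f x
  have i1 : IntervalIntegrable g1 MeasureTheory.volume (-(T / 2)) (T / 2) :=
    gfun_intble j T _ (cont_psi χ.der τ) f x
  have i2 : IntervalIntegrable g2 MeasureTheory.volume (-(T / 2)) (T / 2) :=
    gfun_intble j T _ (cont_psi χ τ) ((X j : MvPolynomial (Fin n) K) • f) x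
  have hd : ∀ s, HasDerivAt g (g1 s + g2 s - τ * g s) s := by
    intro s
    have h1 := χ.hasDerivAt s
    have h2 : HasDerivAt (fun s : ℝ => Complex.exp (-(τ * s))) (Complex.exp (-(τ * s)) * (-τ)) s := by
      have := ((Complex.ofRealCLM.hasDerivAt (x := s)).const_mul τ).neg.cexp
      simpa using this
    have h3 : HasDerivAt (fun s => Function.update x j s) (Pi.single j 1) s := hasDerivAt_update x j s
    have h4 := (Cinf.differentiable f (Function.update x j s)).hasFDerivAt.comp_hasDerivAt s h3
    rw [← X_smul_apply K j f] at h4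
    have h5 := (h1.mul h2).mul h4
    have h6 : g1 s + g2 s - τ * g s = (χ.der.1 s * Complex.exp (-(τ * s)) +
        χ.1 s * (Complex.exp (-(τ * s)) * -τ)) * f.1 (Function.update x j s) +
        χ.1 s * Complex.exp (-(τ * s)) *
        ((X j : MvPolynomial (Fin n) K) • f).1 (Function.update x j s) := by
      simp only [g, g1, g2]; ring
    rw [h6]
    exact h5
  have h0 := intervalIntegral.integral_eq_sub_of_hasDerivAt (a := -(T / 2)) (b := T / 2)
    (fun s _ => hd s) ((i1.add i2).sub (i0.const_mul τ))
  have z1 : χ.1 (T / 2) = 0 := χ.2.2 _ fun h => absurd h.2 (not_le.2 hβ)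
  have z2 : χ.1 (-(T / 2)) = 0 := χ.2.2 _ fun h => absurd h.1 (not_le.2 hα)
  rw [intervalIntegral.integral_sub (i1.add i2) (i0.const_mul τ), intervalIntegral.integral_add i1 i2,
    intervalIntegral.integral_const_mul] at h0
  have z3 : g (T / 2) - g (-(T / 2)) = 0 := by simp only [g, z1, z2]; simp
  rw [z3] at h0
  exact (sub_eq_zero.1 h0).symm

end FMap

end

noncomputable section
set_option linter.unusedSectionVars false
open MvPolynomial
open scoped ContDiff

section FMap2

variable {n : ℕ} {K : Type} [CommRing K] [Algebra K ℂ] [Module (MvPolynomial (Fin n) K) (Cinf n)]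
  [DMod n K]

variable {I : Type} {τ : I → Fin n → ℂ} {w : I → ℝ} {j : Fin n} {T θ : ℝ} {α β : ℝ}

/-- admissible coefficients -/
def Adm (c : ℤ → ℂ) (α β : ℝ) : Prop :=
  ∀ N : ℕ, ∃ C : ℝ, ∀ lam : ℤ, ∀ s ∈ Set.Icc α β,
    ‖c lam‖ * Real.exp (-(lam * s)) * (1 + |(lam : ℝ)|) ^ N ≤ C

theorem update_mem_slice {x : Fin n → ℝ} {R s : ℝ} (hx : x ∈ slice n j.val R)
    (hs : s ∈ Set.Icc α β) : Function.update x j s ∈ slice n (j.val + 1) (|R| + (|α| + |β|)) := by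
  intro m
  have h1 := abs_nonneg α
  have h2 := abs_nonneg β
  have h3 := abs_nonneg R
  by_cases hm : m = j
  · subst hm
    rw [Function.update_self]
    refine ⟨?_, fun h => by omega⟩
    have := abs_le_max_abs_abs hs.1 hs.2
    have h4 := max_le_add_of_nonneg h1 h2
    linarith
  · rw [Function.update_of_ne hm]
    refine ⟨?_, fun h => (hx m).2 (by omega)⟩
    have := (hx m).1
    have := le_abs_self R
    linarith

theorem Fbd0 (hT : 0 ≤ T) (χ : Cut α β) {c : ℤ → ℂ} (hc : Adm c α β) (h : W K (j.val + 1) τ w)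
    (M : ℕ) (R : ℝ) : ∃ C : ℝ, ∀ l, ∀ x ∈ slice n j.val R,
      ‖(Fint K j T χ (tau' τ j T θ l j) (h.1 l.1)).1 x‖ *
        (‖c l.2.2‖ * (1 + |(l.2.2 : ℝ)|) ^ M * |w l.1| ^ M) ≤ C := by
  obtain ⟨D, hD0, hD⟩ := χ.bound
  obtain ⟨C1, hC1⟩ := h.2.2 1 M (|R| + (|α| + |β|))
  obtain ⟨C2, hC2⟩ := hc M
  let e : ℝ := Real.exp (|θ| * (|α| + |β|))
  refine ⟨(D * e * max C1 0 * max C2 0) * |T / 2 - -(T / 2)|, fun l x hx => ?_⟩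
  have hxj : x j = 0 := (hx j).2 le_rfl
  set Y : ℝ := ‖c l.2.2‖ * (1 + |(l.2.2 : ℝ)|) ^ M * |w l.1| ^ M with hY
  have hY0 : 0 ≤ Y := by positivity
  rw [Fint_apply, hxj, Complex.ofReal_zero, mul_zero, Complex.exp_zero, one_mul]
  have : ∀ z : ℂ, ‖z‖ * Y = ‖z * (Y : ℂ)‖ := fun z => by
    rw [norm_mul, Complex.norm_real, Real.norm_eq_abs, abs_of_nonneg hY0]
  rw [this, ← intervalIntegral.integral_mul_const]
  refine intervalIntegral.norm_integral_le_of_norm_le_const fun s _ => ?_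
  rw [norm_mul, norm_mul, norm_mul, Complex.norm_real, Real.norm_eq_abs, abs_of_nonneg hY0,
    Complex.norm_exp]
  by_cases hs : s ∈ Set.Icc α β
  · have h1 := hC1 l.1 _ (update_mem_slice hx hs)
    rw [one_smul] at h1
    have h1' := h1.trans (le_max_left C1 0)
    have h2' := (hC2 l.2.2 s hs).trans (le_max_left C2 0)
    have h3 : (-(tau' τ j T θ l j * s)).re = -(l.2.2 * s) + -(θ * s) := by
      rw [Complex.neg_re, Complex.re_mul_ofReal, tau_re]; ring
    have h4 : Real.exp (-(θ * s)) ≤ e := by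
      apply Real.exp_le_exp.2
      refine (le_abs_self _).trans ?_
      rw [abs_neg, abs_mul]
      have h5 := abs_le_max_abs_abs hs.1 hs.2
      have h6 := max_le_add_of_nonneg (abs_nonneg α) (abs_nonneg β)
      exact mul_le_mul_of_nonneg_left (h5.trans h6) (abs_nonneg _)
    rw [h3, Real.exp_add]
    have h0 : 0 ≤ max C1 0 := le_max_right _ _
    have h0' : 0 ≤ max C2 0 := le_max_right _ _
    calc ‖χ.1 s‖ * (Real.exp (-(l.2.2 * s)) * Real.exp (-(θ * s))) *
          ‖(h.1 l.1).1 (Function.update x j s)‖ * Y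
        = ‖χ.1 s‖ * Real.exp (-(θ * s)) * (‖(h.1 l.1).1 (Function.update x j s)‖ * |w l.1| ^ M) *
          (‖c l.2.2‖ * Real.exp (-(l.2.2 * s)) * (1 + |(l.2.2 : ℝ)|) ^ M) := by
          rw [hY]; ring
      _ ≤ D * e * max C1 0 * max C2 0 := by
          have := hD s
          gcongr
  · rw [χ.2.2 s hs]
    simp only [norm_zero, zero_mul]
    positivity

theorem W_smul_apply {j : ℕ} {τ : I → Fin n → ℂ} (p : MvPolynomial (Fin n) K) (h : W K j τ w) (i : I) :
    (p • h).1 i = p • h.1 i := rfl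

theorem tau_im (l : I × ℤ × ℤ) : (tau' τ j T θ l j).im = 2 * Real.pi * l.2.1 / T := by
  have : 2 * Real.pi * Complex.I * l.2.1 / T = ((2 * Real.pi * l.2.1 / T : ℝ) : ℂ) * Complex.I := by
    push_cast; ring
  simp only [tau', this, Function.update_self]
  simp

theorem FbdN (hT : 0 < T) (hα : -(T / 2) < α) (hβ : β < T / 2) {c : ℤ → ℂ} (hc : Adm c α β)
    (M N : ℕ) (R : ℝ) (χ : Cut α β) (h : W K (j.val + 1) τ w) :
    ∃ C : ℝ, ∀ l, ∀ x ∈ slice n j.val R,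
      ‖(Fint K j T χ (tau' τ j T θ l j) (h.1 l.1)).1 x‖ *
        (‖c l.2.2‖ * (1 + |(l.2.2 : ℝ)|) ^ M * |w l.1| ^ M) * (1 + |(l.2.1 : ℝ)|) ^ N ≤ C := by
  induction N generalizing χ h with
  | zero =>
    obtain ⟨C, hC⟩ := Fbd0 (θ := θ) hT.le χ hc h M R
    exact ⟨C, fun l x hx => by rw [pow_zero, mul_one]; exact hC l x hx⟩
  | succ N ih =>
    obtain ⟨C1, hC1⟩ := ih χ h
    obtain ⟨C2, hC2⟩ := ih χ.der h
    obtain ⟨C3, hC3⟩ := ih χ ((X j : MvPolynomial (Fin n) K) • h)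
    refine ⟨C1 + T / (2 * Real.pi) * (C2 + C3), fun l x hx => ?_⟩
    have h1 := hC1 l x hx
    have h2 := hC2 l x hx
    have h3 := hC3 l x hx
    rw [W_smul_apply] at h3
    set t := tau' τ j T θ l j with ht
    have hp := congrArg (fun f : Cinf n => ‖f.1 x‖) (Fint_parts K j T χ t hα hβ (h.1 l.1))
    simp only [csmul_apply', add_apply', norm_mul] at hp
    set Y : ℝ := ‖c l.2.2‖ * (1 + |(l.2.2 : ℝ)|) ^ M * |w l.1| ^ M with hY
    have hY0 : 0 ≤ Y := by positivity
    set F0 := (Fint K j T χ t (h.1 l.1)).1 x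
    set F1 := (Fint K j T χ.der t (h.1 l.1)).1 x
    set F2 := (Fint K j T χ t ((X j : MvPolynomial (Fin n) K) • h.1 l.1)).1 x
    have hk : |(l.2.1 : ℝ)| ≤ T / (2 * Real.pi) * ‖t‖ := by
      have h4 := Complex.abs_im_le_norm t
      rw [ht, tau_im, ← ht] at h4
      have hpi := Real.pi_pos
      have h5 : (l.2.1 : ℝ) = T / (2 * Real.pi) * (2 * Real.pi * l.2.1 / T) := by
        field_simp
      rw [h5, abs_mul, abs_of_pos (show 0 < T / (2 * Real.pi) by positivity)]
      gcongr
    have hn := norm_add_le F1 F2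
    have hpi := Real.pi_pos
    calc ‖F0‖ * Y * (1 + |(l.2.1 : ℝ)|) ^ (N + 1)
        = ‖F0‖ * Y * (1 + |(l.2.1 : ℝ)|) ^ N +
          |(l.2.1 : ℝ)| * ‖F0‖ * Y * (1 + |(l.2.1 : ℝ)|) ^ N := by ring
      _ ≤ ‖F0‖ * Y * (1 + |(l.2.1 : ℝ)|) ^ N +
          T / (2 * Real.pi) * ‖t‖ * ‖F0‖ * Y * (1 + |(l.2.1 : ℝ)|) ^ N := by gcongr
      _ = ‖F0‖ * Y * (1 + |(l.2.1 : ℝ)|) ^ N +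
          T / (2 * Real.pi) * (‖F1 + F2‖ * Y * (1 + |(l.2.1 : ℝ)|) ^ N) := by
          rw [← hp]; ring
      _ ≤ ‖F0‖ * Y * (1 + |(l.2.1 : ℝ)|) ^ N +
          T / (2 * Real.pi) * ((‖F1‖ + ‖F2‖) * Y * (1 + |(l.2.1 : ℝ)|) ^ N) := by gcongr
      _ = ‖F0‖ * Y * (1 + |(l.2.1 : ℝ)|) ^ N +
          T / (2 * Real.pi) * (‖F1‖ * Y * (1 + |(l.2.1 : ℝ)|) ^ N +
            ‖F2‖ * Y * (1 + |(l.2.1 : ℝ)|) ^ N) := by ring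
      _ ≤ _ := by gcongr

theorem Fdecay (hT : 0 < T) (hα : -(T / 2) < α) (hβ : β < T / 2) {c : ℤ → ℂ} (hc : Adm c α β)
    (p : MvPolynomial (Fin n) K) (N : ℕ) (R : ℝ) (χ : Cut α β) (h : W K (j.val + 1) τ w) :
    ∃ C : ℝ, ∀ l, ∀ x ∈ slice n j.val R,
      ‖(p • Fint K j T χ (tau' τ j T θ l j) (h.1 l.1)).1 x‖ * ‖c l.2.2‖ * |wt' w l| ^ N ≤ C := by
  induction p using MvPolynomial.induction_on generalizing χ h with
  | C a =>
    obtain ⟨C, hC⟩ := FbdN (θ := θ) hT hα hβ hc N N R χ h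
    refine ⟨‖algebraMap K ℂ a‖ * C, fun l x hx => ?_⟩
    have h1 := hC l x hx
    rw [C_smul_apply, norm_mul]
    have h2 : |wt' w l| = |w l.1| * ((1 + |(l.2.1 : ℝ)|) * (1 + |(l.2.2 : ℝ)|)) := by
      unfold wt'
      rw [abs_mul, abs_of_pos (a := (1 + |(l.2.1 : ℝ)|) * (1 + |(l.2.2 : ℝ)|)) (by positivity)]
    rw [h2, mul_pow, mul_pow]
    refine le_trans (le_of_eq ?_) (mul_le_mul_of_nonneg_left h1 (norm_nonneg _))
    ring
  | add p q hp hq =>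
    obtain ⟨C, hC⟩ := hp χ h
    obtain ⟨D, hD⟩ := hq χ h
    refine ⟨C + D, fun l x hx => le_trans ?_ (add_le_add (hC l x hx) (hD l x hx))⟩
    rw [add_smul, add_apply', ← add_mul, ← add_mul]
    gcongr
    exact norm_add_le _ _
  | mul_X p m hp =>
    by_cases hm : m = j
    · subst hm
      obtain ⟨C, hC⟩ := hp χ.der h
      obtain ⟨D, hD⟩ := hp χ ((X m : MvPolynomial (Fin n) K) • h)
      refine ⟨C + D, fun l x hx => le_trans ?_ (add_le_add (hC l x hx) (hD l x hx))⟩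
      rw [mul_smul, X_Fint, Fint_parts K m T χ _ hα hβ, smul_add, add_apply', ← add_mul, ← add_mul,
        W_smul_apply]
      gcongr
      exact norm_add_le _ _
    · obtain ⟨D, hD⟩ := hp χ ((X m : MvPolynomial (Fin n) K) • h)
      refine ⟨D, fun l x hx => le_trans (le_of_eq ?_) (hD l x hx)⟩
      rw [mul_smul, X_Fint_ne K j T χ _ _ m hm, W_smul_apply]

variable (K) in
/-- the family of (weighted) Fourier coefficients of `χ h` -/
def FmapAux (hT : 0 < T) (hα : -(T / 2) < α) (hβ : β < T / 2) {c : ℤ → ℂ} (hc : Adm c α β)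
    (χ : Cut α β) (τ : I → Fin n → ℂ) (w : I → ℝ) (j : Fin n) (θ : ℝ) :
    W K (j.val + 1) τ w →+ W K j.val (tau' τ j T θ) (wt' w) where
  toFun h := ⟨fun l => (c l.2.2 / T) • Fint K j T χ (tau' τ j T θ l j) (h.1 l.1), by
    refine ⟨fun l m hm => ?_, fun p N R => ?_⟩
    · rw [poly_smul_csmul, smul_comm (tau' τ j T θ l m)]
      congr 1
      by_cases hmj : m = j
      · subst hmj; rw [X_Fint]
      · have hm' : j.val + 1 ≤ m.val := by
          have : m.val ≠ j.val := fun h' => hmj (Fin.ext h')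
          omega
        rw [X_Fint_ne K j T χ _ _ m hmj, h.2.1 _ m hm', Fint_csmul, tau_of_gt l m hm']
    · obtain ⟨C, hC⟩ := Fdecay (θ := θ) hT hα hβ hc p N R χ h
      refine ⟨T⁻¹ * C, fun l x hx => ?_⟩
      rw [poly_smul_csmul, csmul_apply', norm_mul, norm_div, Complex.norm_real, Real.norm_eq_abs,
        abs_of_pos hT]
      refine le_trans (le_of_eq ?_) (mul_le_mul_of_nonneg_left (hC l x hx) (by positivity))
      ring⟩
  map_zero' := by
    apply Subtype.ext; funext l
    change (c l.2.2 / T) • Fint K j T χ (tau' τ j T θ l j) 0 = 0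
    have := Fint_csmul K j T χ (tau' τ j T θ l j) 0 0
    rw [zero_smul, zero_smul] at this
    rw [this, smul_zero]
  map_add' f g := by
    apply Subtype.ext; funext l
    change (c l.2.2 / T) • Fint K j T χ (tau' τ j T θ l j) (f.1 l.1 + g.1 l.1) =
      (c l.2.2 / T) • Fint K j T χ (tau' τ j T θ l j) (f.1 l.1) +
      (c l.2.2 / T) • Fint K j T χ (tau' τ j T θ l j) (g.1 l.1)
    rw [Fint_add, smul_add]

theorem FmapAux_apply (hT : 0 < T) (hα : -(T / 2) < α) (hβ : β < T / 2) {c : ℤ → ℂ}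
    (hc : Adm c α β) (χ : Cut α β) (h : W K (j.val + 1) τ w) (l : I × ℤ × ℤ) :
    (FmapAux K hT hα hβ hc χ τ w j θ h).1 l =
      (c l.2.2 / T) • Fint K j T χ (tau' τ j T θ l j) (h.1 l.1) := rfl

variable (K) in
def Fmap (hT : 0 < T) (hα : -(T / 2) < α) (hβ : β < T / 2) {c : ℤ → ℂ} (hc : Adm c α β)
    (χ : Cut α β) (τ : I → Fin n → ℂ) (w : I → ℝ) (j : Fin n) (θ : ℝ) :
    W K (j.val + 1) τ w →ₗ[Bring n K j] W K j.val (tau' τ j T θ) (wt' w) where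
  toFun := FmapAux K hT hα hβ hc χ τ w j θ
  map_add' := map_add _
  map_smul' b h := by
    refine comm_B j (FmapAux K hT hα hβ hc χ τ w j θ) ?_ ?_ b h
    · intro a h
      apply Subtype.ext; funext l
      rw [W_smul_apply, FmapAux_apply, FmapAux_apply, W_smul_apply, DMod.C_smul, DMod.C_smul,
        Fint_csmul, smul_comm]
    · intro m hm h
      apply Subtype.ext; funext l
      rw [W_smul_apply, FmapAux_apply, FmapAux_apply, W_smul_apply, poly_smul_csmul,
        X_Fint_ne K j T χ _ _ m hm]

end FMap2

end

noncomputable section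
set_option linter.unusedSectionVars false
open MvPolynomial
open scoped ContDiff

section Inversion

theorem fourier_inv {T : ℝ} (hT : 0 < T) (g : ℝ → ℂ) (hg : Continuous g)
    (hg0 : g (-(T / 2)) = g (T / 2)) (y : ℝ) (hy : |y| < T / 2)
    (b : ℤ → ℂ) (hb : ∀ k : ℤ, b k = Complex.exp (2 * Real.pi * Complex.I * k * y / T) *
      (1 / T * ∫ s in (-(T / 2))..(T / 2), Complex.exp (-(2 * Real.pi * Complex.I * k * s / T)) * g s))
    (hs : Summable b) : ∑' k, b k = g y := by
  haveI : Fact (0 < T) := ⟨hT⟩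
  have hend : -(T / 2) + T = T / 2 := by ring
  have hcont : Continuous (AddCircle.liftIco T (-(T / 2)) g) :=
    AddCircle.liftIco_continuous (by rw [hend]; exact hg0) hg.continuousOn
  let G : C(AddCircle T, ℂ) := ⟨_, hcont⟩
  have hco : ∀ k : ℤ, fourierCoeff (⇑G) k =
      1 / T * ∫ s in (-(T / 2))..(T / 2), Complex.exp (-(2 * Real.pi * Complex.I * k * s / T)) * g s := by
    intro k
    change fourierCoeff (AddCircle.liftIco T (-(T / 2)) g) k = _
    rw [fourierCoeff_liftIco_eq, fourierCoeffOn_eq_integral]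
    rw [show -(T / 2) + T - -(T / 2) = T by ring, hend, Complex.real_smul]
    push_cast
    congr 1
    apply intervalIntegral.integral_congr
    intro s _
    simp only [smul_eq_mul, fourier_coe_apply]
    push_cast
    congr 2
    ring
  have hb' : ∀ k : ℤ, b k = fourierCoeff (⇑G) k • (fourier k) (y : AddCircle T) := by
    intro k
    rw [hb, hco, fourier_coe_apply, smul_eq_mul, mul_comm]
  have hsum : Summable (fourierCoeff (⇑G)) := by
    apply Summable.of_norm
    refine hs.norm.congr fun k => ?_
    rw [hb', norm_smul, fourier_coe_apply]
    have : (2 * Real.pi * Complex.I * k * y / T : ℂ) = ((2 * Real.pi * k * y / T : ℝ) : ℂ) * Complex.I := by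
      push_cast; ring
    rw [this, Complex.norm_exp_ofReal_mul_I, mul_one]
  have := has_pointwise_sum_fourier_series_of_summable hsum (y : AddCircle T)
  rw [← funext hb'] at this
  rw [this.tsum_eq]
  change AddCircle.liftIco T (-(T / 2)) g y = g y
  apply AddCircle.liftIco_coe_apply
  rw [hend]
  obtain ⟨h1, h2⟩ := abs_lt.1 hy
  exact ⟨h1.le, h2⟩

variable {n : ℕ} {K : Type} [CommRing K] [Algebra K ℂ] [Module (MvPolynomial (Fin n) K) (Cinf n)]
  [DMod n K]

variable {I : Type} {τ : I → Fin n → ℂ} {w : I → ℝ} {j : Fin n} {T θ : ℝ} {α β : ℝ}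

theorem tau_val (l : I × ℤ × ℤ) : tau' τ j T θ l j =
    (l.2.2 : ℂ) + θ + 2 * Real.pi * Complex.I * l.2.1 / T := by
  simp [tau']

theorem synth_Fmap (hw : ∀ i, 1 ≤ w i) (hT : 0 < T) (hα : -(T / 2) < α) (hβ : β < T / 2) {c : ℤ → ℂ}
    (hc : Adm c α β) (χ : Cut α β) (h : W K (j.val + 1) τ w) (lam : ℤ) (i : I) (x : Fin n → ℝ)
    (hx : |x j| < T / 2) :
    ((synth hw lam (Fmap K hT hα hβ hc χ τ w j θ h)).1 i).1 x =
      c lam * χ.1 (x j) * (h.1 i).1 x := by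
  rw [synth_apply]
  let z : ℂ := lam + θ
  let g : ℝ → ℂ := fun s => c lam * Complex.exp (z * x j) *
    (χ.1 s * Complex.exp (-(z * s)) * (h.1 i).1 (Function.update x j s))
  have hgc : Continuous g := by
    have h1 := cont_psi χ z
    have h2 := (Cinf.continuous (h.1 i)).comp (continuous_const.update j continuous_id : Continuous fun s : ℝ => Function.update x j s)
    exact continuous_const.mul (h1.mul h2)
  have h0 : ∀ s, s ∉ Set.Icc α β → g s = 0 := fun s hs => by
    simp only [g, χ.2.2 s hs]; ring
  have key := fourier_inv hT g hgc
    (by rw [h0 _ (fun h => absurd h.1 (by linarith)), h0 _ (fun h => absurd h.2 (by linarith))])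
    (x j) hx
    (fun k => ((Fmap K hT hα hβ hc χ τ w j θ h).1 (i, k, lam)).1 x) (fun k => ?_)
    ((synth_bdd hw (Fmap K hT hα hβ hc χ τ w j θ h) lam i).summable x)
  · rw [key]
    simp only [g, Function.update_eq_self]
    rw [show c lam * Complex.exp (z * x j) * (χ.1 (x j) * Complex.exp (-(z * x j)) * (h.1 i).1 x) =
      c lam * χ.1 (x j) * (h.1 i).1 x * (Complex.exp (z * x j) * Complex.exp (-(z * x j))) by ring,
      ← Complex.exp_add, add_neg_cancel, Complex.exp_zero, mul_one]
  · change ((c lam / T) • Fint K j T χ (tau' τ j T θ (i, k, lam) j) (h.1 i)).1 x = _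
    rw [csmul_apply', Fint_apply, tau_val]
    simp only
    have e1 : ∀ s : ℝ, ((lam : ℂ) + θ + 2 * Real.pi * Complex.I * k / T) * s =
        z * s + 2 * Real.pi * Complex.I * k * s / T := fun s => by
      simp only [z]; ring
    have e2 : ∫ s in (-(T / 2))..(T / 2), Complex.exp (-(2 * Real.pi * Complex.I * k * s / T)) * g s =
        (c lam * Complex.exp (z * x j)) * ∫ s in (-(T / 2))..(T / 2),
      χ.1 s * Complex.exp (-(((lam : ℂ) + θ + 2 * Real.pi * Complex.I * k / T) * s)) *
        (h.1 i).1 (Function.update x j s) := by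
      rw [← intervalIntegral.integral_const_mul]
      apply intervalIntegral.integral_congr
      intro s _
      simp only [g]
      rw [e1, neg_add, Complex.exp_add]
      ring
    rw [e2, e1, Complex.exp_add]
    ring

end Inversion

end

noncomputable section
set_option linter.unusedSectionVars false
open MvPolynomial
open scoped ContDiff

section MulE

variable {n : ℕ} {K : Type} [CommRing K] [Algebra K ℂ] [Module (MvPolynomial (Fin n) K) (Cinf n)]
  [DMod n K]

variable {I : Type} {τ : I → Fin n → ℂ} {w : I → ℝ} {j : Fin n}

theorem mulT_decay (p : MvPolynomial (Fin n) K) (N : ℕ) (R : ℝ) (ρ : ℝ → ℂ) (hρ : ContDiff ℝ ∞ ρ)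
    (h : W K (j.val + 1) τ w) : ∃ C : ℝ, ∀ i, ∀ x ∈ slice n (j.val + 1) R,
      ‖(p • mulT j ρ hρ (h.1 i)).1 x‖ * |w i| ^ N ≤ C := by
  induction p using MvPolynomial.induction_on generalizing ρ h with
  | C a =>
    obtain ⟨C, hC⟩ := h.2.2 (MvPolynomial.C a) N R
    obtain ⟨D, hD⟩ := (isCompact_Icc (a := -R) (b := R)).exists_bound_of_continuousOn
      hρ.continuous.continuousOn
    refine ⟨max D 0 * max C 0, fun i x hx => ?_⟩
    have h1 := hC i x hx
    have h2 := hD (x j) (abs_le.1 (hx j).1)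
    rw [C_smul_apply, norm_mul] at h1 ⊢
    rw [mulT_apply, norm_mul]
    have h0 : 0 ≤ max D 0 := le_max_right _ _
    calc _ = ‖ρ (x j)‖ * (‖algebraMap K ℂ a‖ * ‖(h.1 i).1 x‖ * |w i| ^ N) := by ring
      _ ≤ _ := by
        gcongr
        · exact h2.trans (le_max_left _ _)
        · exact h1.trans (le_max_left _ _)
  | add p q hp hq =>
    obtain ⟨C, hC⟩ := hp ρ hρ h
    obtain ⟨D, hD⟩ := hq ρ hρ h
    refine ⟨C + D, fun l x hx => le_trans ?_ (add_le_add (hC l x hx) (hD l x hx))⟩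
    rw [add_smul, add_apply', ← add_mul]
    gcongr
    exact norm_add_le _ _
  | mul_X p m hp =>
    obtain ⟨C, hC⟩ := hp ρ hρ ((X m : MvPolynomial (Fin n) K) • h)
    obtain ⟨D, hD⟩ := hp (deriv ρ) (contDiff_infty_iff_deriv.1 hρ).2 h
    refine ⟨C + max D 0, fun i x hx => ?_⟩
    have h1 := hC i x hx
    have h2 := hD i x hx
    rw [W_smul_apply] at h1
    rw [mul_smul, X_mulT, smul_add, add_apply']
    refine le_trans (mul_le_mul_of_nonneg_right (norm_add_le _ _) (by positivity)) ?_
    rw [add_mul]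
    refine add_le_add h1 ?_
    split_ifs
    · exact h2.trans (le_max_left _ _)
    · rw [smul_zero, zero_apply', norm_zero, zero_mul]; exact le_max_right _ _

variable (K τ w j) in
def mulEAux (ρ : ℝ → ℂ) (hρ : ContDiff ℝ ∞ ρ) : W K (j.val + 1) τ w →+ W K (j.val + 1) τ w where
  toFun h := ⟨fun i => mulT j ρ hρ (h.1 i), by
    refine ⟨fun i m hm => ?_, fun p N R => mulT_decay p N R ρ hρ h⟩
    have hmj : m ≠ j := by rintro rfl; omega
    rw [X_mulT, if_neg hmj, add_zero, h.2.1 i m hm]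
    apply Subtype.ext; funext x
    rw [mulT_apply, csmul_apply', csmul_apply', mulT_apply]; ring⟩
  map_zero' := by
    apply Subtype.ext; funext i
    change mulT j ρ hρ 0 = 0
    rw [map_zero]
  map_add' f g := by
    apply Subtype.ext; funext i
    change mulT j ρ hρ (f.1 i + g.1 i) = mulT j ρ hρ (f.1 i) + mulT j ρ hρ (g.1 i)
    rw [map_add]

theorem mulEAux_apply (ρ : ℝ → ℂ) (hρ : ContDiff ℝ ∞ ρ) (h : W K (j.val + 1) τ w) (i : I) :
    (mulEAux K τ w j ρ hρ h).1 i = mulT j ρ hρ (h.1 i) := rfl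

variable (K τ w j) in
def mulE (ρ : ℝ → ℂ) (hρ : ContDiff ℝ ∞ ρ) :
    W K (j.val + 1) τ w →ₗ[Bring n K j] W K (j.val + 1) τ w where
  toFun := mulEAux K τ w j ρ hρ
  map_add' := map_add _
  map_smul' b h := by
    refine comm_B j (mulEAux K τ w j ρ hρ) ?_ ?_ b h
    · intro a h
      apply Subtype.ext; funext i
      rw [W_smul_apply, mulEAux_apply, mulEAux_apply, W_smul_apply, DMod.C_smul, DMod.C_smul]
      apply Subtype.ext; funext x
      rw [mulT_apply, csmul_apply', csmul_apply', mulT_apply]; ring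
    · intro m hm h
      apply Subtype.ext; funext i
      rw [W_smul_apply, mulEAux_apply, mulEAux_apply, W_smul_apply, X_mulT, if_neg hm, add_zero]

theorem mulE_apply (ρ : ℝ → ℂ) (hρ : ContDiff ℝ ∞ ρ) (h : W K (j.val + 1) τ w) (i : I)
    (x : Fin n → ℝ) : ((mulE K τ w j ρ hρ h).1 i).1 x = ρ (x j) * (h.1 i).1 x := rfl

end MulE

end

noncomputable section
set_option linter.unusedSectionVars false
open MvPolynomial
open scoped ContDiff

section Core

variable {n : ℕ} {K : Type} [CommRing K] [Algebra K ℂ] [Module (MvPolynomial (Fin n) K) (Cinf n)]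
  [DMod n K]

variable {I : Type} {τ : I → Fin n → ℂ} {w : I → ℝ} {j : Fin n}

/-- equality on the set of points with `x j ∈ S` -/
def EqS (S : Set ℝ) (g h : W K (j.val + 1) τ w) : Prop :=
  ∀ i x, x j ∈ S → (g.1 i).1 x = (h.1 i).1 x

theorem EqS.rfl' {S : Set ℝ} (g : W K (j.val + 1) τ w) : EqS S g g := fun _ _ _ => rfl

theorem EqS.symm {S : Set ℝ} {g h : W K (j.val + 1) τ w} (H : EqS S g h) : EqS S h g :=
  fun i x hx => (H i x hx).symm

theorem EqS.trans {S : Set ℝ} {g h k : W K (j.val + 1) τ w} (H : EqS S g h) (H' : EqS S h k) :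
    EqS S g k := fun i x hx => (H i x hx).trans (H' i x hx)

theorem EqS.mono {S S' : Set ℝ} {g h : W K (j.val + 1) τ w} (H : EqS S g h) (hS : S' ⊆ S) :
    EqS S' g h := fun i x hx => H i x (hS hx)

theorem EqS.smul {S : Set ℝ} (hS : IsOpen S) {g h : W K (j.val + 1) τ w} (H : EqS S g h)
    (p : MvPolynomial (Fin n) K) : EqS S (p • g) (p • h) := by
  intro i x hx
  exact poly_smul_congr p {x | x j ∈ S} (hS.preimage (continuous_apply j)) _ _
    (fun y hy => H i y hy) x hx

theorem EqS.add {S : Set ℝ} {g h g' h' : W K (j.val + 1) τ w} (H : EqS S g h) (H' : EqS S g' h') :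
    EqS S (g + g') (h + h') := by
  intro i x hx
  change (g.1 i).1 x + (g'.1 i).1 x = (h.1 i).1 x + (h'.1 i).1 x
  rw [H i x hx, H' i x hx]

theorem EqS.sub {S : Set ℝ} {g h g' h' : W K (j.val + 1) τ w} (H : EqS S g h) (H' : EqS S g' h') :
    EqS S (g - g') (h - h') := by
  intro i x hx
  change (g.1 i).1 x - (g'.1 i).1 x = (h.1 i).1 x - (h'.1 i).1 x
  rw [H i x hx, H' i x hx]

/-- the defect of `A`-linearity of a `B`-linear map -/
def deltaG {E : Type} [AddCommGroup E] [Module (MvPolynomial (Fin n) K) E]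
    (F : MvPolynomial (Fin n) K →ₗ[Bring n K j] E) : MvPolynomial (Fin n) K →ₗ[Bring n K j] E where
  toFun a := (X j : MvPolynomial (Fin n) K) • F a - F (X j * a)
  map_add' a b := by rw [map_add, mul_add, map_add, smul_add]; abel
  map_smul' b a := by
    have h1 : X j * (b • a) = b • (X j * a) := by rw [mul_smul_comm]
    rw [h1, map_smul, map_smul, RingHom.id_apply, smul_sub]
    congr 1
    change (X j : MvPolynomial (Fin n) K) • (b : MvPolynomial (Fin n) K) • F a =
      (b : MvPolynomial (Fin n) K) • (X j : MvPolynomial (Fin n) K) • F a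
    rw [smul_comm]

def deltaL (F : MvPolynomial (Fin n) K →ₗ[Bring n K j] W K (j.val + 1) τ w) :
    MvPolynomial (Fin n) K →ₗ[Bring n K j] W K (j.val + 1) τ w :=
  deltaG (n := n) (K := K) (j := j) (E := W K (j.val + 1) τ w) F

theorem deltaL_apply (F : MvPolynomial (Fin n) K →ₗ[Bring n K j] W K (j.val + 1) τ w)
    (a : MvPolynomial (Fin n) K) :
    deltaL F a = (X j : MvPolynomial (Fin n) K) • F a - F (X j * a) := rfl

def subG {E : Type} [AddCommGroup E] [Module (MvPolynomial (Fin n) K) E]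
    (F G : MvPolynomial (Fin n) K →ₗ[Bring n K j] E) : MvPolynomial (Fin n) K →ₗ[Bring n K j] E :=
  F - G

def subL (F G : MvPolynomial (Fin n) K →ₗ[Bring n K j] W K (j.val + 1) τ w) :
    MvPolynomial (Fin n) K →ₗ[Bring n K j] W K (j.val + 1) τ w :=
  subG (n := n) (K := K) (j := j) (E := W K (j.val + 1) τ w) F G

theorem subL_apply (F G : MvPolynomial (Fin n) K →ₗ[Bring n K j] W K (j.val + 1) τ w)
    (a : MvPolynomial (Fin n) K) : subL F G a = F a - G a := rfl

theorem csub' (c : ℂ) (f g : Cinf n) : c • f - c • g = c • (f - g) := by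
  apply Subtype.ext; funext x
  change c * f.1 x - c * g.1 x = c * (f.1 x - g.1 x)
  ring

theorem psub' (p : MvPolynomial (Fin n) K) (f g : Cinf n) : p • (f - g) = p • f - p • g :=
  smul_sub p f g

theorem deltaL_val (F : MvPolynomial (Fin n) K →ₗ[Bring n K j] W K (j.val + 1) τ w)
    (a : MvPolynomial (Fin n) K) (i : I) :
    (deltaL F a).1 i = (X j : MvPolynomial (Fin n) K) • (F a).1 i - (F (X j * a)).1 i := rfl

theorem subL_val (F G : MvPolynomial (Fin n) K →ₗ[Bring n K j] W K (j.val + 1) τ w)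
    (a : MvPolynomial (Fin n) K) (i : I) : (subL F G a).1 i = (F a).1 i - (G a).1 i := rfl

theorem deltaL_sub (F G : MvPolynomial (Fin n) K →ₗ[Bring n K j] W K (j.val + 1) τ w)
    (a : MvPolynomial (Fin n) K) (i : I) :
    (deltaL (subL F G) a).1 i = (deltaL F a).1 i - (deltaL G a).1 i := by
  rw [deltaL_val, deltaL_val, deltaL_val, subL_val, subL_val, psub']
  abel

theorem smul_of_delta {S : Set ℝ} (hS : IsOpen S)
    (F : MvPolynomial (Fin n) K →ₗ[Bring n K j] W K (j.val + 1) τ w)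
    (hF : ∀ a, EqS S (deltaL F a) 0) (a : MvPolynomial (Fin n) K) : EqS S (F a) (a • F 1) := by
  induction a using MvPolynomial.induction_on with
  | C c =>
    have h1 : F (C c) = (⟨C c, Subalgebra.algebraMap_mem _ c⟩ : Bring n K j) • F 1 := by
      rw [← map_smul]; congr 1
      change C c = C c * 1
      rw [mul_one]
    rw [h1]; exact EqS.rfl' _
  | add p q hp hq => rw [map_add, add_smul]; exact hp.add hq
  | mul_X p m hp =>
    by_cases hm : m = j
    · subst hm
      have h1 := hF p
      have h2 := hp.smul hS (X m : MvPolynomial (Fin n) K)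
      rw [smul_smul] at h2
      have h3 : F (p * X m) = (X m : MvPolynomial (Fin n) K) • F p - deltaL F p := by rw [deltaL_apply, mul_comm p]; abel
      rw [h3, mul_comm p]
      have h4 := h2.sub h1
      exact h4.trans fun i x hx => by
        change ((((X m * p : MvPolynomial (Fin n) K) • F 1).1 i).1 x) - 0 = _
        rw [sub_zero]
    · have hmem : (X m : MvPolynomial (Fin n) K) ∈ Bring n K j := by
        rw [Bring, supported_eq_adjoin_X]
        exact Algebra.subset_adjoin ⟨m, hm, rfl⟩
      have h1 : F (p * X m) = (⟨X m, hmem⟩ : Bring n K j) • F p := by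
        rw [← map_smul]; congr 1
        change p * X m = X m * p
        rw [mul_comm]
      rw [h1, mul_comm, mul_smul]
      exact hp.smul hS (X m)

/-- local solvability of `p • f = φ p` -/
def Sol {J : Ideal (MvPolynomial (Fin n) K)}
    (φ : J →ₗ[MvPolynomial (Fin n) K] W K (j.val + 1) τ w) (S : Set ℝ)
    (f : W K (j.val + 1) τ w) : Prop :=
  ∀ p (hp : p ∈ J), EqS S (p • f) (φ ⟨p, hp⟩)

theorem Sol_of_delta {J : Ideal (MvPolynomial (Fin n) K)}
    (φ : J →ₗ[MvPolynomial (Fin n) K] W K (j.val + 1) τ w) {S : Set ℝ} (hS : IsOpen S)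
    (F : MvPolynomial (Fin n) K →ₗ[Bring n K j] W K (j.val + 1) τ w)
    (hF : ∀ a, EqS S (deltaL F a) 0) (hJ : ∀ p (hp : p ∈ J), EqS S (F p) (φ ⟨p, hp⟩)) :
    Sol φ S (F 1) := fun p hp => (smul_of_delta hS F hF p).symm.trans (hJ p hp)

theorem exists_cut (a b c d : ℝ) (hab : a < b) (hcd : c < d) :
    ∃ χ : Cut a d, ∀ t ∈ Set.Icc b c, χ.1 t = 1 := by
  let f : ℝ → ℝ := fun t => Real.smoothTransition ((t - a) / (b - a)) *
    Real.smoothTransition ((d - t) / (d - c))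
  have hf : ContDiff ℝ ∞ f := by
    refine ContDiff.mul (Real.smoothTransition.contDiff.comp ?_) (Real.smoothTransition.contDiff.comp ?_)
    · fun_prop
    · fun_prop
  refine ⟨⟨fun t => (f t : ℂ), Complex.ofRealCLM.contDiff.comp hf, fun s hs => ?_⟩, fun t ht => ?_⟩
  · have : f s = 0 := by
      simp only [f]
      by_cases h : a ≤ s
      · have h2 : d < s := by by_contra h3; exact hs ⟨h, not_lt.1 h3⟩
        rw [Real.smoothTransition.zero_of_nonpos (x := (d - s) / (d - c)), mul_zero]
        exact div_nonpos_of_nonpos_of_nonneg (by linarith) (by linarith)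
      · rw [Real.smoothTransition.zero_of_nonpos, zero_mul]
        exact div_nonpos_of_nonpos_of_nonneg (by linarith) (by linarith)
    change (f s : ℂ) = 0
    rw [this, Complex.ofReal_zero]
  · have : f t = 1 := by
      simp only [f]
      rw [Real.smoothTransition.one_of_one_le, Real.smoothTransition.one_of_one_le, mul_one]
      · rw [le_div_iff₀ (by linarith)]; linarith [ht.2]
      · rw [le_div_iff₀ (by linarith)]; linarith [ht.1]
    change (f t : ℂ) = 1
    rw [this, Complex.ofReal_one]

theorem Adm_single (α β : ℝ) : Adm (Pi.single 0 1) α β := by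
  intro N
  refine ⟨1, fun lam s hs => ?_⟩
  by_cases h : lam = 0
  · subst h; simp
  · rw [Pi.single_eq_of_ne h]; simp

theorem exp_pow_bound (N : ℕ) : ∃ C : ℝ, ∀ t : ℝ, 0 ≤ t → Real.exp (-(t / 4)) * (1 + t) ^ N ≤ C := by
  refine ⟨4 ^ N * N.factorial * Real.exp (1 / 4), fun t ht => ?_⟩
  have h := Real.pow_div_factorial_le_exp ((1 + t) / 4) (by positivity) N
  rw [div_pow, div_div, div_le_iff₀ (by positivity)] at h
  calc Real.exp (-(t / 4)) * (1 + t) ^ N ≤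
        Real.exp (-(t / 4)) * (Real.exp ((1 + t) / 4) * (4 ^ N * N.factorial)) := by gcongr
    _ = 4 ^ N * N.factorial * (Real.exp (-(t / 4)) * Real.exp ((1 + t) / 4)) := by ring
    _ = _ := by rw [← Real.exp_add]; congr 2; ring

def cpos (a : ℝ) : ℤ → ℂ := fun lam => if 0 ≤ lam then Real.exp (lam * a) else 0

def cneg (a : ℝ) : ℤ → ℂ := fun lam => if lam ≤ 0 then Real.exp (-(lam * a)) else 0

theorem Adm_pos {a α β : ℝ} (h : a + 1 / 4 ≤ α) : Adm (cpos a) α β := by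
  intro N
  obtain ⟨C, hC⟩ := exp_pow_bound N
  refine ⟨max C 0, fun lam s hs => ?_⟩
  unfold cpos
  split_ifs with hl
  · have hl' : (0 : ℝ) ≤ lam := by exact_mod_cast hl
    refine le_trans ?_ ((hC lam hl').trans (le_max_left _ _))
    rw [Complex.norm_real, Real.norm_eq_abs, abs_of_pos (Real.exp_pos _), ← Real.exp_add, abs_of_nonneg hl']
    have : lam * a + -(lam * s) ≤ -(lam / 4 : ℝ) := by nlinarith [hs.1]
    gcongr
  · simp

theorem Adm_neg {a α β : ℝ} (h : β ≤ -(a + 1 / 4)) : Adm (cneg a) α β := by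
  intro N
  obtain ⟨C, hC⟩ := exp_pow_bound N
  refine ⟨max C 0, fun lam s hs => ?_⟩
  unfold cneg
  split_ifs with hl
  · have hl' : (0 : ℝ) ≤ -lam := by exact_mod_cast neg_nonneg.2 hl
    refine le_trans ?_ ((hC (-lam) hl').trans (le_max_left _ _))
    rw [Complex.norm_real, Real.norm_eq_abs, abs_of_pos (Real.exp_pos _), ← Real.exp_add, ← abs_neg (lam : ℝ),
      abs_of_nonneg hl']
    have : -(lam * a) + -(lam * s) ≤ -(-lam / 4 : ℝ) := by nlinarith [hs.2]
    gcongr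
  · simp

variable (τ w j) in
/-- the inductive assumption -/
def HBaer (K : Type) [CommRing K] [Algebra K ℂ] [Module (MvPolynomial (Fin n) K) (Cinf n)]
    [DMod n K] : Prop :=
  ∀ T : ℝ, 0 < T → ∃ θ ∈ Set.Icc (0 : ℝ) 1,
    Module.Baer (MvPolynomial (Fin n) K) (W K j.val (tau' τ j T θ) (wt' w))

theorem exists_big (hB : HBaer τ w j K) (hw : ∀ i, 1 ≤ w i) {J : Ideal (MvPolynomial (Fin n) K)}
    (φ : J →ₗ[MvPolynomial (Fin n) K] W K (j.val + 1) τ w) (r : ℝ) (hr : 0 < r) :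
    ∃ F : MvPolynomial (Fin n) K →ₗ[Bring n K j] W K (j.val + 1) τ w,
      ∀ p (hp : p ∈ J), EqS {t | |t| < r} (F p) (φ ⟨p, hp⟩) := by
  have hT : 0 < 2 * r + 10 := by linarith
  obtain ⟨θ, -, hBa⟩ := hB (2 * r + 10) hT
  obtain ⟨χ, hχ⟩ := exists_cut (-(r + 1)) (-r) r (r + 1) (by linarith) (by linarith)
  have hα : -((2 * r + 10) / 2) < -(r + 1) := by linarith
  have hβ : r + 1 < (2 * r + 10) / 2 := by linarith
  let c : ℤ → ℂ := Pi.single 0 1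
  have hc : Adm c (-(r + 1)) (r + 1) := Adm_single _ _
  obtain ⟨Φ, hΦ⟩ := ext_ideal j hBa J
    ((Fmap K hT hα hβ hc χ τ w j θ).comp (φ.restrictScalars (Bring n K j)))
  refine ⟨((synth hw 0).restrictScalars (Bring n K j)).comp Φ, fun p hp i x hx => ?_⟩
  rw [LinearMap.comp_apply, hΦ p hp]
  have := synth_Fmap (θ := θ) hw hT hα hβ hc χ (φ ⟨p, hp⟩) 0 i x
    (by rw [Set.mem_ofPred_eq] at hx; linarith)
  refine this.trans ?_
  have hx' := abs_lt.1 (show |x j| < r from hx)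
  rw [hχ (x j) ⟨hx'.1.le, hx'.2.le⟩]
  simp [c]

theorem synth_sub {T θ : ℝ} (hw : ∀ i, 1 ≤ w i) (lam : ℤ) (u v : W K j.val (tau' τ j T θ) (wt' w))
    (i : I) : (synth hw lam (u - v)).1 i = (synth hw lam u).1 i - (synth hw lam v).1 i := by
  have e : u - v + v = u := Subtype.ext (funext fun i => sub_add_cancel (u.1 i) (v.1 i))
  have h := map_add (synth hw lam) (u - v) v
  rw [e] at h
  rw [h]
  exact (add_sub_cancel_right ((synth hw lam (u - v)).1 i) ((synth hw lam v).1 i)).symm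

theorem core (hB : HBaer τ w j K) (hw : ∀ i, 1 ≤ w i) (J : Ideal (MvPolynomial (Fin n) K))
    (F : MvPolynomial (Fin n) K →ₗ[Bring n K j] W K (j.val + 1) τ w)
    {α β T : ℝ} (hT : 0 < T) (hα : -(T / 2) < α) (hβ : β < T / 2) {c : ℤ → ℂ} (hc : Adm c α β)
    (χ : Cut α β) (hJ : ∀ p ∈ J, ∀ (i : I) (x : Fin n → ℝ), χ.1 (x j) * ((deltaL F p).1 i).1 x = 0) :
    ∃ D : ℤ → MvPolynomial (Fin n) K →ₗ[Bring n K j] W K (j.val + 1) τ w,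
      (∀ lam, ∀ p ∈ J, D lam p = 0) ∧
      (∀ lam, c lam ≠ 0 → ∀ (a : MvPolynomial (Fin n) K) (i : I) (x : Fin n → ℝ), |x j| < T / 2 →
        ((deltaL (D lam) a).1 i).1 x = χ.1 (x j) * ((deltaL F a).1 i).1 x) ∧
      (∃ θ ∈ Set.Icc (0 : ℝ) 1, ∀ (p : MvPolynomial (Fin n) K) (N : ℕ) (R : ℝ), ∃ C : ℝ, 0 ≤ C ∧
        ∀ lam i, ∀ x ∈ slice n (j.val + 1) R,
          ‖(p • (D lam 1).1 i).1 x‖ * |w i| ^ N ≤ ‖c lam‖⁻¹ * (C * Real.exp ((lam + θ) * x j))) := by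
  obtain ⟨θ, hθ, hBa⟩ := hB T hT
  obtain ⟨Φ, hΦJ, hΦ⟩ := delta_ideal j hBa J ((Fmap K hT hα hβ hc χ τ w j θ).comp (deltaL F)) (by
    intro p hp
    apply Subtype.ext; funext l
    change (c l.2.2 / T) • Fint K j T χ (tau' τ j T θ l j) ((deltaL F p).1 l.1) = 0
    apply Subtype.ext; funext x
    rw [csmul_apply', Fint_apply, zero_apply']
    have : (∫ s in (-(T / 2))..(T / 2), χ.1 s * Complex.exp (-(tau' τ j T θ l j * s)) *
        ((deltaL F p).1 l.1).1 (Function.update x j s)) = ∫ s in (-(T / 2))..(T / 2), (0 : ℂ) := by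
      apply intervalIntegral.integral_congr
      intro s _
      have h1 := hJ p hp l.1 (Function.update x j s)
      rw [Function.update_self] at h1
      simp only
      rw [mul_right_comm, h1, zero_mul]
    rw [this]; simp)
  let D : ℤ → MvPolynomial (Fin n) K →ₗ[Bring n K j] W K (j.val + 1) τ w := fun lam =>
    (mulE K τ w j (fun _ => (c lam)⁻¹) contDiff_const).comp
      (((synth hw lam).restrictScalars (Bring n K j)).comp Φ)
  have hD : ∀ lam a i x, ((D lam a).1 i).1 x = (c lam)⁻¹ * ((synth hw lam (Φ a)).1 i).1 x :=
    fun lam a i x => rfl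
  have hD' : ∀ lam a i, (D lam a).1 i = (c lam)⁻¹ • (synth hw lam (Φ a)).1 i := fun lam a i => rfl
  refine ⟨D, fun lam p hp => ?_, fun lam hl a i x hx => ?_, θ, hθ, fun p N R => ?_⟩
  · apply Subtype.ext; funext i
    rw [hD', hΦJ p hp, map_zero]
    exact smul_zero _
  · have h1 : (deltaL (D lam) a).1 i =
        (c lam)⁻¹ • (synth hw lam ((X j : MvPolynomial (Fin n) K) • Φ a - Φ (X j * a))).1 i := by
      change (X j : MvPolynomial (Fin n) K) • (D lam a).1 i - (D lam (X j * a)).1 i = _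
      rw [hD', hD', poly_smul_csmul, csub', synth_sub, map_smul]
      rfl
    rw [h1, hΦ a, csmul_apply', LinearMap.comp_apply, synth_Fmap hw hT hα hβ hc χ _ lam i x hx,
      mul_assoc, inv_mul_cancel_left₀ hl]
  · obtain ⟨C, hC0, hC⟩ := synth_bound' hw (Φ 1) p N R
    refine ⟨C, hC0, fun lam i x hx => ?_⟩
    rw [hD', poly_smul_csmul, csmul_apply', norm_mul, norm_inv, mul_assoc]
    exact mul_le_mul_of_nonneg_left (hC lam i x hx) (by positivity)

end Core

end

noncomputable section
set_option linter.unusedSectionVars false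
open MvPolynomial
open scoped ContDiff

section Step

variable {n : ℕ} {K : Type} [CommRing K] [Algebra K ℂ] [Module (MvPolynomial (Fin n) K) (Cinf n)]
  [DMod n K]

variable {I : Type} {τ : I → Fin n → ℂ} {w : I → ℝ} {j : Fin n}

theorem isOpen_abs (r : ℝ) : IsOpen {t : ℝ | |t| < r} := isOpen_lt continuous_abs continuous_const

theorem delta_of_lin {S : Set ℝ} (hS : IsOpen S) {F : MvPolynomial (Fin n) K →ₗ[Bring n K j] W K (j.val + 1) τ w}
    {a : MvPolynomial (Fin n) K} {u v : W K (j.val + 1) τ w} (h1 : EqS S (F a) u)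
    (h2 : EqS S (F (X j * a)) v) (huv : (X j : MvPolynomial (Fin n) K) • u = v) :
    EqS S (deltaL F a) 0 := by
  subst huv
  have := (h1.smul hS (X j)).sub h2
  rw [deltaL_apply]
  refine this.trans fun i x hx => ?_
  exact sub_self _

theorem initial (hB : HBaer τ w j K) (hw : ∀ i, 1 ≤ w i) {J : Ideal (MvPolynomial (Fin n) K)}
    (φ : J →ₗ[MvPolynomial (Fin n) K] W K (j.val + 1) τ w) : ∃ f, Sol φ {t | |t| < 1} f := by
  obtain ⟨F, hF⟩ := exists_big hB hw φ 2 (by norm_num)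
  obtain ⟨χ, hχ⟩ := exists_cut (-(3 / 2)) (-1) 1 (3 / 2) (by norm_num) (by norm_num)
  have hd : ∀ p ∈ J, EqS {t | |t| < 2} (deltaL F p) 0 := fun p hp =>
    delta_of_lin (isOpen_abs 2) (hF p hp) (hF (X j * p) (J.mul_mem_left _ hp))
      (by rw [← map_smul]; rfl)
  obtain ⟨D, hDJ, hD, -⟩ := core (T := 10) hB hw J F (by norm_num) (by norm_num) (by norm_num)
    (Adm_single _ _) χ (fun p hp i x => by
      by_cases hx : x j ∈ Set.Icc (-(3 / 2) : ℝ) (3 / 2)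
      · have hx2 : |x j| < 2 := abs_lt.2 ⟨by linarith [hx.1], by linarith [hx.2]⟩
        have h3 : ((deltaL F p).1 i).1 x = 0 := hd p hp i x hx2
        rw [h3, mul_zero]
      · rw [χ.2.2 _ hx, zero_mul])
  refine ⟨subL F (D 0) 1, Sol_of_delta φ (isOpen_abs 1) _ (fun a i x hx => ?_) (fun p hp i x hx => ?_)⟩
  · have hx1 : |x j| < 1 := hx
    have hx2 := abs_lt.1 hx1
    have h1 := hD 0 (by simp) a i x (by linarith)
    rw [hχ _ ⟨hx2.1.le, hx2.2.le⟩, one_mul] at h1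
    rw [deltaL_sub, sub_apply', h1, sub_self]
    rfl
  · have hx1 : |x j| < 1 := hx
    rw [subL_val, hDJ 0 p hp]
    refine Eq.trans ?_ (hF p hp i x (by change |x j| < 2; linarith))
    exact sub_zero _

theorem exists_lam (M ε : ℝ) (hε : 0 < ε) : ∃ l : ℕ, M * Real.exp (-((l : ℝ) / 4)) ≤ ε := by
  obtain ⟨l, hl⟩ := exists_nat_ge (4 * (M / ε))
  refine ⟨l, ?_⟩
  have h1 := Real.add_one_le_exp ((l : ℝ) / 4)
  rw [Real.exp_neg, ← div_eq_mul_inv, div_le_iff₀ (Real.exp_pos _)]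
  have h2 : M / ε ≤ Real.exp ((l : ℝ) / 4) := by linarith
  rw [div_le_iff₀ hε] at h2
  linarith

theorem step (hB : HBaer τ w j K) (hw : ∀ i, 1 ≤ w i) {J : Ideal (MvPolynomial (Fin n) K)}
    (φ : J →ₗ[MvPolynomial (Fin n) K] W K (j.val + 1) τ w) (k : ℝ) (hk : 1 ≤ k)
    (f : W K (j.val + 1) τ w) (hf : Sol φ {t | |t| < k} f) (Q : Finset (MvPolynomial (Fin n) K))
    (N : ℕ) (R ε : ℝ) (hε : 0 < ε) :
    ∃ f' : W K (j.val + 1) τ w, Sol φ {t | |t| < k + 1} f' ∧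
      ∀ p ∈ Q, ∀ i, ∀ x ∈ slice n (j.val + 1) R, |x j| ≤ k - 1 →
        ‖(p • (f'.1 i - f.1 i)).1 x‖ * |w i| ^ N ≤ ε := by
  obtain ⟨Fb, hFb⟩ := exists_big hB hw φ (k + 2) (by linarith)
  obtain ⟨ρ, hρ⟩ := exists_cut (-(k - 1 / 8)) (-(k - 1 / 4)) (k - 1 / 4) (k - 1 / 8)
    (by linarith) (by linarith)
  let FA : MvPolynomial (Fin n) K →ₗ[Bring n K j] W K (j.val + 1) τ w :=
    (LinearMap.toSpanSingleton (MvPolynomial (Fin n) K) (W K (j.val + 1) τ w) f).restrictScalars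
      (Bring n K j)
  let F := subL Fb ((mulE K τ w j ρ.1 ρ.2.1).comp (subL Fb FA))
  have hFv : ∀ a i x, ((F a).1 i).1 x = ((Fb a).1 i).1 x -
      ρ.1 (x j) * (((Fb a).1 i).1 x - ((a • f).1 i).1 x) := fun a i x => rfl
  have hk1 : ∀ a, EqS {t | |t| < k - 1 / 4} (F a) (a • f) := by
    intro a i x hx
    have hx' := abs_lt.1 (show |x j| < k - 1 / 4 from hx)
    rw [hFv, hρ _ ⟨hx'.1.le, hx'.2.le⟩]; ring
  have hk2 : ∀ p (hp : p ∈ J), EqS {t | |t| < k + 2} (F p) (φ ⟨p, hp⟩) := by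
    intro p hp i x hx
    rw [hFv, hFb p hp i x hx]
    by_cases hx2 : |x j| < k
    · rw [hf p hp i x hx2]; ring
    · have : ρ.1 (x j) = 0 := ρ.2.2 _ fun h => hx2 (abs_lt.2 ⟨by linarith [h.1], by linarith [h.2]⟩)
      rw [this]; ring
  have d1 : ∀ a, EqS {t | |t| < k - 1 / 4} (deltaL F a) 0 := fun a =>
    delta_of_lin (isOpen_abs _) (hk1 a) (hk1 (X j * a)) (by rw [smul_smul])
  have d2 : ∀ p ∈ J, EqS {t | |t| < k + 2} (deltaL F p) 0 := fun p hp =>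
    delta_of_lin (isOpen_abs _) (hk2 p hp) (hk2 (X j * p) (J.mul_mem_left _ hp))
      (by rw [← map_smul]; rfl)
  obtain ⟨χ1, hχ1⟩ := exists_cut (k - 1 / 2) (k - 1 / 4) (k + 1) (k + 3 / 2)
    (by linarith) (by linarith)
  obtain ⟨χ2, hχ2⟩ := exists_cut (-(k + 3 / 2)) (-(k + 1)) (-(k - 1 / 4)) (-(k - 1 / 2))
    (by linarith) (by linarith)
  obtain ⟨D1, hD1J, hD1, θ1, hθ1, hb1⟩ := core (T := 2 * k + 10) (c := cpos (k - 3 / 4)) hB hw J F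
    (by linarith) (by linarith) (by linarith) (Adm_pos (by linarith)) χ1 (fun p hp i x => by
      by_cases hx : x j ∈ Set.Icc (k - 1 / 2) (k + 3 / 2)
      · have hx2 : |x j| < k + 2 := abs_lt.2 ⟨by linarith [hx.1], by linarith [hx.2]⟩
        have h3 : ((deltaL F p).1 i).1 x = 0 := d2 p hp i x hx2
        rw [h3, mul_zero]
      · rw [χ1.2.2 _ hx, zero_mul])
  obtain ⟨D2, hD2J, hD2, θ2, hθ2, hb2⟩ := core (T := 2 * k + 10) (c := cneg (k - 3 / 4)) hB hw J F
    (by linarith) (by linarith) (by linarith) (Adm_neg (by linarith)) χ2 (fun p hp i x => by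
      by_cases hx : x j ∈ Set.Icc (-(k + 3 / 2)) (-(k - 1 / 2))
      · have hx2 : |x j| < k + 2 := abs_lt.2 ⟨by linarith [hx.1], by linarith [hx.2]⟩
        have h3 : ((deltaL F p).1 i).1 x = 0 := d2 p hp i x hx2
        rw [h3, mul_zero]
      · rw [χ2.2.2 _ hx, zero_mul])
  choose C1 hC10 hC1 using fun p => hb1 p N R
  choose C2 hC20 hC2 using fun p => hb2 p N R
  let M : ℝ := (∑ p ∈ Q, (C1 p + C2 p)) * Real.exp k
  obtain ⟨l, hl⟩ := exists_lam M ε hε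
  have hc1 : cpos (k - 3 / 4) (l : ℤ) = (Real.exp (l * (k - 3 / 4)) : ℂ) := by
    unfold cpos
    rw [if_pos (by positivity)]
    push_cast; rfl
  have hc2 : cneg (k - 3 / 4) (-(l : ℤ)) = (Real.exp (l * (k - 3 / 4)) : ℂ) := by
    unfold cneg
    rw [if_pos (by simp)]
    push_cast; simp
  have hne : (Real.exp (l * (k - 3 / 4)) : ℂ) ≠ 0 := by
    exact_mod_cast (Real.exp_pos _).ne'
  have hnorm : ‖(Real.exp (l * (k - 3 / 4)) : ℂ)‖⁻¹ = Real.exp (-(l * (k - 3 / 4))) := by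
    rw [Complex.norm_real, Real.norm_eq_abs, abs_of_pos (Real.exp_pos _), Real.exp_neg]
  have hFv2 : ∀ a i, (subL (subL F (D1 l)) (D2 (-l)) a).1 i =
      (F a).1 i - (D1 l a).1 i - (D2 (-l) a).1 i := fun a i => rfl
  refine ⟨subL (subL F (D1 l)) (D2 (-l)) 1, Sol_of_delta φ (isOpen_abs _) _ (fun a i x hx => ?_)
    (fun p hp i x hx => ?_), fun p hp i x hx hxj => ?_⟩
  · have hx1 : |x j| < k + 1 := hx
    have hx2 := abs_lt.1 hx1
    have e1 := hD1 l (by rw [hc1]; exact hne) a i x (by linarith)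
    have e2 := hD2 (-l) (by rw [hc2]; exact hne) a i x (by linarith)
    rw [deltaL_sub, sub_apply', deltaL_sub, sub_apply', e1, e2]
    change _ = (0 : ℂ)
    by_cases h3 : |x j| < k - 1 / 4
    · have h4 : ((deltaL F a).1 i).1 x = 0 := d1 a i x h3
      rw [h4]; ring
    · rcases le_total 0 (x j) with h5 | h5
      · rw [abs_of_nonneg h5] at h3
        rw [hχ1 _ ⟨by linarith, hx2.2.le⟩, χ2.2.2 _ (fun h => by linarith [h.2])]; ring
      · rw [abs_of_nonpos h5] at h3
        rw [hχ2 _ ⟨hx2.1.le, by linarith⟩, χ1.2.2 _ (fun h => by linarith [h.1])]; ring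
  · have hx1 : |x j| < k + 1 := hx
    rw [hFv2, hD1J l p hp, hD2J (-l) p hp, ← hk2 p hp i x (show |x j| < k + 2 by linarith)]
    change ((F p).1 i).1 x - 0 - 0 = _
    ring
  · have hx2 := abs_le.1 hxj
    have hEq : (p • ((subL (subL F (D1 l)) (D2 (-l)) 1).1 i - f.1 i)).1 x =
        -((p • (D1 l 1).1 i).1 x + (p • (D2 (-l) 1).1 i).1 x) := by
      have := poly_smul_congr p {x | x j ∈ {t : ℝ | |t| < k - 1 / 4}}
        ((isOpen_abs _).preimage (continuous_apply j))
        ((subL (subL F (D1 l)) (D2 (-l)) 1).1 i - f.1 i)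
        (-((D1 l 1).1 i + (D2 (-l) 1).1 i)) (fun y hy => by
          have h6 := hk1 1 i y hy
          rw [one_smul] at h6
          rw [hFv2, sub_apply', sub_apply', sub_apply', h6]
          change _ = -(((D1 l 1).1 i).1 y + ((D2 (-l) 1).1 i).1 y)
          ring) x (show |x j| < k - 1 / 4 by linarith)
      rw [this, smul_neg, smul_add]
      rfl
    have b1 := hC1 p l i x hx
    have b2 := hC2 p (-l) i x hx
    rw [hc1, hnorm] at b1
    rw [hc2, hnorm] at b2
    have hl0 : (0 : ℝ) ≤ l := by positivity
    have g1 : Real.exp (-(l * (k - 3 / 4))) * (C1 p * Real.exp ((((l : ℤ) : ℝ) + θ1) * x j)) ≤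
        C1 p * (Real.exp k * Real.exp (-((l : ℝ) / 4))) := by
      rw [mul_left_comm, ← Real.exp_add, ← Real.exp_add]
      refine mul_le_mul_of_nonneg_left (Real.exp_le_exp.2 ?_) (hC10 p)
      push_cast
      have q1 : θ1 * x j ≤ k := by nlinarith [hθ1.1, hθ1.2]
      nlinarith
    have g2 : Real.exp (-(l * (k - 3 / 4))) * (C2 p * Real.exp ((((-l : ℤ) : ℝ) + θ2) * x j)) ≤
        C2 p * (Real.exp k * Real.exp (-((l : ℝ) / 4))) := by
      rw [mul_left_comm, ← Real.exp_add, ← Real.exp_add]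
      refine mul_le_mul_of_nonneg_left (Real.exp_le_exp.2 ?_) (hC20 p)
      push_cast
      have q1 : θ2 * x j ≤ k := by nlinarith [hθ2.1, hθ2.2]
      nlinarith
    have g3 : C1 p + C2 p ≤ ∑ p ∈ Q, (C1 p + C2 p) :=
      Finset.single_le_sum (f := fun p => C1 p + C2 p) (fun q _ => add_nonneg (hC10 q) (hC20 q)) hp
    rw [hEq, norm_neg]
    calc _ ≤ (‖(p • (D1 l 1).1 i).1 x‖ + ‖(p • (D2 (-l) 1).1 i).1 x‖) * |w i| ^ N := by
          gcongr; exact norm_add_le _ _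
      _ = ‖(p • (D1 l 1).1 i).1 x‖ * |w i| ^ N + ‖(p • (D2 (-l) 1).1 i).1 x‖ * |w i| ^ N := by ring
      _ ≤ C1 p * (Real.exp k * Real.exp (-((l : ℝ) / 4))) +
          C2 p * (Real.exp k * Real.exp (-((l : ℝ) / 4))) := add_le_add (b1.trans g1) (b2.trans g2)
      _ = (C1 p + C2 p) * (Real.exp k * Real.exp (-((l : ℝ) / 4))) := by ring
      _ ≤ (∑ p ∈ Q, (C1 p + C2 p)) * (Real.exp k * Real.exp (-((l : ℝ) / 4))) := by gcongr
      _ = M * Real.exp (-((l : ℝ) / 4)) := by simp only [M]; ring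
      _ ≤ ε := hl

end Step

end

noncomputable section
set_option linter.unusedSectionVars false
open MvPolynomial
open scoped ContDiff

section Limit

variable {n : ℕ} {K : Type} [CommRing K] [Algebra K ℂ] [Module (MvPolynomial (Fin n) K) (Cinf n)]
  [DMod n K]

variable {I : Type} {τ : I → Fin n → ℂ} {w : I → ℝ} {j : ℕ}

theorem bdd_of_slice (d : ℕ → W K j τ w)
    (hd : ∀ (p : MvPolynomial (Fin n) K) (N : ℕ) (R : ℝ), ∃ b : ℕ → ℝ, Summable b ∧
      ∀ k i, ∀ x ∈ slice n j R, ‖(p • (d k).1 i).1 x‖ * |w i| ^ N ≤ b k) (i : I) :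
    Bdd K fun k => (d k).1 i := by
  intro p R
  obtain ⟨b, hb, hb'⟩ := hd p 0 R
  refine ⟨fun k => Real.exp (∑ m, ‖τ i m‖ * |R|) * b k, hb.mul_left _, fun k x hx => ?_⟩
  have h1 := freq_formula (K := K) j (τ i) (p • (d k).1 i) (fun m hm => by
    rw [← mul_smul, mul_comm, mul_smul, (d k).2.1 i m hm, poly_smul_csmul]) x
  have h2 := hb' k i (projj j x) (projj_mem j x R hx)
  rw [pow_zero, mul_one] at h2
  rw [h1, norm_mul]
  refine mul_le_mul ?_ h2 (norm_nonneg _) (Real.exp_nonneg _)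
  refine (Complex.norm_exp_le_exp_norm _).trans (Real.exp_le_exp.2 ?_)
  refine (norm_sum_le _ _).trans (Finset.sum_le_sum fun m _ => ?_)
  split_ifs
  · rw [norm_mul, Complex.norm_real, Real.norm_eq_abs]
    exact mul_le_mul_of_nonneg_left ((hx m).trans (le_abs_self R)) (norm_nonneg _)
  · rw [norm_zero]; positivity

theorem W_csum (d : ℕ → W K j τ w)
    (hd : ∀ (p : MvPolynomial (Fin n) K) (N : ℕ) (R : ℝ), ∃ b : ℕ → ℝ, Summable b ∧
      ∀ k i, ∀ x ∈ slice n j R, ‖(p • (d k).1 i).1 x‖ * |w i| ^ N ≤ b k) :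
    ∃ g : W K j τ w, ∀ (p : MvPolynomial (Fin n) K) i x,
      HasSum (fun k => (p • (d k).1 i).1 x) ((p • g.1 i).1 x) := by
  have hs : ∀ (p : MvPolynomial (Fin n) K) i x, HasSum (fun k => (p • (d k).1 i).1 x)
      ((p • csum _ (bdd_of_slice d hd i)).1 x) := fun p i x => by
    rw [smul_csum_apply]
    exact (((bdd_of_slice d hd i).smul p).summable x).hasSum
  refine ⟨⟨fun i => csum _ (bdd_of_slice d hd i), fun i m hm => ?_, fun p N R => ?_⟩, hs⟩
  · refine Subtype.ext (funext fun x => ?_)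
    change ((X m : MvPolynomial (Fin n) K) • csum _ (bdd_of_slice d hd i)).1 x
      = (τ i m • csum _ (bdd_of_slice d hd i)).1 x
    rw [smul_csum_apply, csmul_apply', csum_apply, ← tsum_mul_left]
    refine tsum_congr fun k => ?_
    rw [(d k).2.1 i m hm, csmul_apply']
  · obtain ⟨b, hb, hb'⟩ := hd p N R
    refine ⟨∑' k, b k, fun i x hx => ?_⟩
    have h1 := ((hs p i x).mul_left ((|w i| ^ N : ℝ) : ℂ)).tsum_eq
    have h2 : ‖((|w i| ^ N : ℝ) : ℂ) * (p • csum _ (bdd_of_slice d hd i)).1 x‖ ≤ ∑' k, b k := by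
      rw [← h1]
      refine tsum_of_norm_bounded hb.hasSum fun k => ?_
      rw [norm_mul, Complex.norm_real, Real.norm_of_nonneg (by positivity), mul_comm]
      exact hb' k i x hx
    rw [norm_mul, Complex.norm_real, Real.norm_of_nonneg (by positivity), mul_comm] at h2
    exact h2

end Limit

section Limit2

variable {n : ℕ} {K : Type} [CommRing K] [Algebra K ℂ] [Module (MvPolynomial (Fin n) K) (Cinf n)]
  [DMod n K]

variable {I : Type} {τ : I → Fin n → ℂ} {w : I → ℝ} {j : Fin n}

theorem countable_poly [Countable K] : Countable (MvPolynomial (Fin n) K) := by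
  have : Function.Injective (fun p : MvPolynomial (Fin n) K => AddMonoidAlgebra.coeff p) :=
    fun p q h => AddMonoidAlgebra.ext h
  exact this.countable

theorem baer_succ [Countable K] (hB : HBaer τ w j K) (hw : ∀ i, 1 ≤ w i) :
    Module.Baer (MvPolynomial (Fin n) K) (W K (j.val + 1) τ w) := by
  classical
  intro J φ
  have := countable_poly (n := n) (K := K)
  obtain ⟨e, he⟩ := exists_surjective_nat (MvPolynomial (Fin n) K)
  obtain ⟨f0, hf0⟩ := initial hB hw φ
  have hstep : ∀ (k : ℕ) (f : {f : W K (j.val + 1) τ w // Sol φ {t | |t| < (k : ℝ) + 1} f}),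
      ∃ f' : {f : W K (j.val + 1) τ w // Sol φ {t | |t| < ((k + 1 : ℕ) : ℝ) + 1} f},
      ∀ p ∈ (Finset.range (k + 1)).image e, ∀ i, ∀ x ∈ slice n (j.val + 1) k, |x j| ≤ k →
        ‖(p • (f'.1.1 i - f.1.1 i)).1 x‖ * |w i| ^ k ≤ (1 / 2) ^ k := by
    intro k f
    obtain ⟨f', h1, h2⟩ := step hB hw φ (k + 1) (by simp) f.1 f.2 ((Finset.range (k + 1)).image e)
      k k ((1 / 2) ^ k) (by positivity)
    refine ⟨⟨f', ?_⟩, fun p hp i x hx hxj => h2 p hp i x hx (by simpa using hxj)⟩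
    rw [Nat.cast_add, Nat.cast_one]
    exact h1
  choose nxt hnxt using hstep
  let F : ∀ k : ℕ, {f : W K (j.val + 1) τ w // Sol φ {t | |t| < (k : ℝ) + 1} f} := fun k =>
    Nat.rec ⟨f0, by simpa using hf0⟩ (fun k f => nxt k f) k
  have hF : ∀ k, F (k + 1) = nxt k (F k) := fun k => rfl
  let d : ℕ → W K (j.val + 1) τ w := fun k => (F (k + 1)).1 - (F k).1
  have hd0 : ∀ k i, (d k).1 i = (F (k + 1)).1.1 i - (F k).1.1 i := fun k i => rfl
  have hd : ∀ (p : MvPolynomial (Fin n) K) (N : ℕ) (R : ℝ), ∃ b : ℕ → ℝ, Summable b ∧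
      ∀ k i, ∀ x ∈ slice n (j.val + 1) R, ‖(p • (d k).1 i).1 x‖ * |w i| ^ N ≤ b k := by
    intro p N R
    obtain ⟨a, rfl⟩ := he p
    obtain ⟨r, hr⟩ := exists_nat_ge R
    choose C hC using fun k => (d k).2.2 (e a) N R
    refine ⟨fun k => (1 / 2) ^ k + if k ∈ Finset.range (a + N + r) then |C k| else 0, ?_,
      fun k i x hx => ?_⟩
    · refine Summable.add (summable_geometric_of_lt_one (by norm_num) (by norm_num)) ?_
      exact summable_of_ne_finset_zero (s := Finset.range (a + N + r)) fun k hk => if_neg hk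
    · dsimp only
      split_ifs with hk
      · have := hC k i x hx
        have h2 := le_abs_self (C k)
        have h3 : (0 : ℝ) ≤ (1 / 2) ^ k := by positivity
        linarith
      · rw [Finset.mem_range, not_lt] at hk
        rw [add_zero]
        have hRk : R ≤ k := hr.trans (by exact_mod_cast (by omega))
        have h1 := hnxt k (F k) (e a) (Finset.mem_image_of_mem e (Finset.mem_range.2 (by omega))) i x
          (fun m => ⟨(hx m).1.trans hRk, (hx m).2⟩) ((hx j).1.trans hRk)
        rw [← hF, ← hd0] at h1
        refine le_trans (mul_le_mul_of_nonneg_left ?_ (norm_nonneg _)) h1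
        refine pow_le_pow_right₀ ((hw i).trans (le_abs_self _)) (by omega)
  obtain ⟨g, hg⟩ := W_csum d hd
  refine ⟨LinearMap.toSpanSingleton (MvPolynomial (Fin n) K) (W K (j.val + 1) τ w)
    ((F 0).1 + g), fun p hp => ?_⟩
  rw [LinearMap.toSpanSingleton_apply]
  refine Subtype.ext (funext fun i => Subtype.ext (funext fun x => ?_))
  rw [W_smul_apply]
  change (p • ((F 0).1.1 i + g.1 i)).1 x = _
  rw [smul_add, add_apply']
  have h1 := (hg p i x).tendsto_sum_nat
  have h2 : ∀ k, ∑ l ∈ Finset.range k, (p • (d l).1 i).1 x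
      = (p • (F k).1.1 i).1 x - (p • (F 0).1.1 i).1 x := fun k => by
    rw [← Finset.sum_range_sub (fun k => (p • (F k).1.1 i).1 x)]
    refine Finset.sum_congr rfl fun l _ => ?_
    rw [hd0, psub', sub_apply']
  simp only [h2] at h1
  obtain ⟨r, hr⟩ := exists_nat_ge |x j|
  have h3 : Filter.Tendsto (fun k => (p • (F k).1.1 i).1 x - (p • (F 0).1.1 i).1 x) Filter.atTop
      (nhds (((φ ⟨p, hp⟩).1 i).1 x - (p • (F 0).1.1 i).1 x)) := by
    refine tendsto_const_nhds.congr' ?_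
    filter_upwards [Filter.eventually_ge_atTop r] with k hk
    have h4 : |x j| < (k : ℝ) + 1 := by
      have : (r : ℝ) ≤ k := by exact_mod_cast hk
      linarith
    have := (F k).2 p hp i x h4
    rw [W_smul_apply] at this
    rw [this]
  rw [tendsto_nhds_unique h1 h3]
  ring

theorem baer_all [IsDomain K] [Countable K] (j : ℕ) : ∀ (_ : j ≤ n) {I : Type} (τ : I → Fin n → ℂ) (w : I → ℝ),
    Good K j τ w → Module.Baer (MvPolynomial (Fin n) K) (W K j τ w) := by
  induction j with
  | zero => intro _ I τ w hg; exact baer_zero τ w hg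
  | succ j ih =>
    intro hj I τ w hg
    refine baer_succ (j := ⟨j, hj⟩) (fun T _ => ?_) hg.one_le
    obtain ⟨θ, hθ, hG⟩ := exists_theta (K := K) τ w ⟨j, hj⟩ T hg
    exact ⟨θ, hθ, ih (by omega) _ _ hG⟩

variable (n K) in
theorem baer_cinf [IsDomain K] [Countable K] (hinj : Function.Injective (algebraMap K ℂ)) :
    Module.Baer (MvPolynomial (Fin n) K) (Cinf n) := by
  have hG : Good K n (fun (_ : Unit) (_ : Fin n) => (0 : ℂ)) (fun _ => 1) := by
    refine ⟨fun _ => le_rfl, ⟨0, summable_of_finite_support (Set.toFinite _)⟩, fun p hp h0 => ?_⟩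
    have h1 : {m : Fin n | n ≤ m.val} = ∅ := by
      ext m
      simpa using m.2
    rw [h1, supported_empty, Algebra.mem_bot] at hp
    obtain ⟨c, rfl⟩ := hp
    refine ⟨‖algebraMap K ℂ c‖, norm_pos_iff.2 fun h => h0 ?_, 0, fun i => ?_⟩
    · rw [hinj (h.trans (map_zero _).symm), map_zero]
    · rw [AlgHom.commutes, pow_zero, mul_one]
  have hB := baer_all n le_rfl _ _ hG
  have hmem : ∀ f : Cinf n, (fun _ : Unit => f) ∈ W K n (fun (_ : Unit) (_ : Fin n) => (0 : ℂ)) (fun _ => 1) := by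
    intro f
    refine ⟨fun i m hm => absurd m.2 (by omega), fun p N R => ?_⟩
    have hc : IsCompact (Set.pi Set.univ fun _ : Fin n => Set.Icc (-R) R) :=
      isCompact_univ_pi fun _ => isCompact_Icc
    obtain ⟨C, hC⟩ := hc.exists_bound_of_continuousOn (Cinf.continuous (p • f)).continuousOn
    refine ⟨C, fun i x hx => ?_⟩
    rw [abs_one, one_pow, mul_one]
    exact hC x fun m _ => abs_le.1 (hx m).1
  intro J φ
  let toW : Cinf n →ₗ[MvPolynomial (Fin n) K] W K n (fun (_ : Unit) (_ : Fin n) => (0 : ℂ)) (fun _ => 1) :=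
    { toFun := fun f => ⟨fun _ => f, hmem f⟩
      map_add' := fun f g => rfl
      map_smul' := fun p f => rfl }
  let ofW : W K n (fun (_ : Unit) (_ : Fin n) => (0 : ℂ)) (fun _ => 1) →ₗ[MvPolynomial (Fin n) K] Cinf n :=
    { toFun := fun f => f.1 ()
      map_add' := fun f g => rfl
      map_smul' := fun p f => rfl }
  obtain ⟨g, hg⟩ := hB J (toW ∘ₗ φ)
  refine ⟨ofW ∘ₗ g, fun x hx => ?_⟩
  rw [LinearMap.comp_apply, hg x hx]
  rfl

end Limit2

end

noncomputable section
set_option linter.unusedSectionVars false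
open MvPolynomial
open scoped ContDiff

section Red

variable {n : ℕ} [Module (MvPolynomial (Fin n) ℂ) (Cinf n)] [DMod n ℂ]

variable (n) in
theorem baer_complex : Module.Baer (MvPolynomial (Fin n) ℂ) (Cinf n) := by
  classical
  intro J φ
  obtain ⟨s, hs⟩ : J.FG := IsNoetherian.noetherian J
  let S : Set ℂ := ⋃ p ∈ s, (p.coeffs : Set ℂ)
  let K : Subfield ℂ := Subfield.closure S
  have hS : S.Countable := Set.Countable.biUnion s.countable_toSet fun p _ => p.coeffs.countable_toSet
  have hK : Countable K := by
    rw [← Cardinal.mk_le_aleph0_iff]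
    refine (Subfield.cardinalMk_closure_le_max S).trans (max_le ?_ le_rfl)
    exact Cardinal.le_aleph0_iff_set_countable.2 hS
  let mK : Module (MvPolynomial (Fin n) K) (Cinf n) :=
    Module.compHom (Cinf n) (MvPolynomial.map (σ := Fin n) K.subtype)
  have hsm : ∀ (p : MvPolynomial (Fin n) K) (f : Cinf n), p • f = (MvPolynomial.map K.subtype p) • f :=
    fun p f => rfl
  have hD : DMod n K := by
    refine ⟨fun i f => ?_, fun c f => ?_⟩
    · rw [hsm, map_X]
      exact DMod.X_smul i f
    · rw [hsm, map_C]
      exact DMod.C_smul (K := ℂ) (c : ℂ) f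
  have hB := baer_cinf n K (algebraMap K ℂ).injective
  let J' : Ideal (MvPolynomial (Fin n) K) := J.comap (MvPolynomial.map K.subtype)
  let φ' : J' →ₗ[MvPolynomial (Fin n) K] Cinf n :=
    { toFun := fun x => φ ⟨MvPolynomial.map K.subtype x.1, x.2⟩
      map_add' := fun x y => by
        rw [← map_add]
        congr 1
        exact Subtype.ext (map_add (MvPolynomial.map K.subtype) x.1 y.1)
      map_smul' := fun p x => by
        rw [RingHom.id_apply, hsm, ← map_smul]
        congr 1
        exact Subtype.ext (map_mul (MvPolynomial.map K.subtype) p x.1) }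
  obtain ⟨g, hg⟩ := hB J' φ'
  have hg' : ∀ q (hq : q ∈ J'), q • g 1 = φ' ⟨q, hq⟩ := fun q hq => by
    rw [← hg q hq, ← map_smul, smul_eq_mul, mul_one]
  refine ⟨LinearMap.toSpanSingleton (MvPolynomial (Fin n) ℂ) (Cinf n) (g 1), ?_⟩
  subst hs
  intro x hx
  rw [LinearMap.toSpanSingleton_apply]
  induction hx using Submodule.span_induction with
  | mem p hp =>
    have : p ∈ Set.range (MvPolynomial.map (σ := Fin n) K.subtype) := by
      rw [mem_range_map_iff_coeffs_subset]
      intro c hc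
      exact ⟨⟨c, Subfield.subset_closure (Set.mem_biUnion hp hc)⟩, rfl⟩
    obtain ⟨q, rfl⟩ := this
    exact hg' q (Submodule.subset_span hp)
  | zero =>
    rw [zero_smul]
    exact (map_zero φ).symm
  | add x y hx hy h1 h2 =>
    rw [add_smul, h1, h2, ← map_add]
    rfl
  | smul a x hx h1 =>
    exact (mul_smul a x (g 1)).trans ((congrArg (a • ·) h1).trans (map_smul φ a ⟨x, hx⟩).symm)

end Red

section Embed

theorem embed_free {R : Type} [CommRing R] [IsDomain R] {N : Type} [AddCommGroup N] [Module R N] {k : ℕ}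
    (v : Fin k → N) (hv : Submodule.span R (Set.range v) = ⊤)
    (ht : ∀ p : R, p ≠ 0 → ∀ m : N, p • m = 0 → m = 0) :
    ∃ (s : Set (Fin k)) (f : N →ₗ[R] (s →₀ R)), Function.Injective f := by
  classical
  obtain ⟨s, hs, hs'⟩ := exists_maximal_linearIndepOn R v
  have h1 : ∀ i, ∃ a : R, a ≠ 0 ∧ a • v i ∈ Submodule.span R (v '' s) := fun i => by
    by_cases hi : i ∈ s
    · exact ⟨1, one_ne_zero, by rw [one_smul]; exact Submodule.subset_span ⟨i, hi, rfl⟩⟩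
    · exact hs' i hi
  choose a ha ha' using h1
  have h2 : ∏ i, a i ≠ 0 := Finset.prod_ne_zero_iff.2 fun i _ => ha i
  have h3 : Submodule.span R (v '' s) = Submodule.span R (Set.range fun x : s => v x) := by
    rw [Set.image_eq_range]
  have h4 : ∀ m : N, (∏ i, a i) • m ∈ Submodule.span R (Set.range fun x : s => v x) := by
    intro m
    have hm : m ∈ Submodule.span R (Set.range v) := hv ▸ Submodule.mem_top
    rw [← h3]
    induction hm using Submodule.span_induction with
    | mem x hx =>
      obtain ⟨i, rfl⟩ := hx
      rw [← Finset.prod_erase_mul _ _ (Finset.mem_univ i), mul_smul]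
      exact Submodule.smul_mem _ _ (ha' i)
    | zero => rw [smul_zero]; exact Submodule.zero_mem _
    | add x y _ _ hx hy => rw [smul_add]; exact Submodule.add_mem _ hx hy
    | smul c x _ hx => rw [smul_comm]; exact Submodule.smul_mem _ _ hx
  refine ⟨s, LinearIndependent.repr hs ∘ₗ
    LinearMap.codRestrict _ ((∏ i, a i) • (LinearMap.id : N →ₗ[R] N)) h4, ?_⟩
  rw [← LinearMap.ker_eq_bot, LinearMap.ker_eq_bot']
  intro m hm
  have h5 := LinearMap.ker_eq_bot'.1 (LinearIndependent.repr_ker hs) _ hm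
  exact ht _ h2 m (congrArg Subtype.val h5)

end Embed

end

noncomputable section
set_option linter.unusedSectionVars false
open MvPolynomial
open scoped ContDiff

section Final

variable {n : ℕ} [Module (MvPolynomial (Fin n) ℂ) (Cinf n)] [DMod n ℂ]

theorem cs_smul (p : MvPolynomial (Fin n) ℂ) (g : Cinf n) (hg : HasCompactSupport g.1) :
    HasCompactSupport (p • g).1 := by
  refine HasCompactSupport.intro hg fun x hx => ?_
  have := poly_smul_congr p (tsupport g.1)ᶜ (isClosed_tsupport _).isOpen_compl g 0
    (fun y hy => image_eq_zero_of_notMem_tsupport hy) x hx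
  rw [this, smul_zero]
  rfl

theorem int_mul (g h : Cinf n) (hg : HasCompactSupport g.1) :
    MeasureTheory.Integrable fun x => g.1 x * h.1 x :=
  ((Cinf.continuous g).mul (Cinf.continuous h)).integrable_of_hasCompactSupport hg.mul_right

variable (n) in
def sig : MvPolynomial (Fin n) ℂ →ₐ[ℂ] MvPolynomial (Fin n) ℂ := aeval fun i => -X i

theorem sig_sig (p : MvPolynomial (Fin n) ℂ) : sig n (sig n p) = p := by
  have : (sig n).comp (sig n) = AlgHom.id ℂ _ := by
    refine MvPolynomial.algHom_ext fun i => ?_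
    simp [sig]
  exact DFunLike.congr_fun this p

theorem parts (p : MvPolynomial (Fin n) ℂ) : ∀ (g h : Cinf n), HasCompactSupport g.1 →
    ∫ x, (p • g).1 x * h.1 x = ∫ x, g.1 x * (sig n p • h).1 x := by
  induction p using MvPolynomial.induction_on with
  | C c =>
    intro g h hg
    have : sig n (C c) = C c := by simp [sig, algebraMap_eq]
    rw [this]
    refine MeasureTheory.integral_congr_ae (Filter.Eventually.of_forall fun x => ?_)
    simp only [C_smul_apply]
    ring
  | add p q hp hq =>
    intro g h hg
    rw [map_add]
    simp only [add_smul, add_apply', add_mul, mul_add]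
    rw [MeasureTheory.integral_add (int_mul _ _ (cs_smul p g hg)) (int_mul _ _ (cs_smul q g hg)),
      MeasureTheory.integral_add (int_mul _ _ hg) (int_mul _ _ hg), hp g h hg, hq g h hg]
  | mul_X p i hp =>
    intro g h hg
    rw [mul_smul, hp _ h (cs_smul _ g hg)]
    have h1 : sig n (p * X i) = C (-1) * (X i * sig n p) := by
      rw [map_mul]
      simp [sig, mul_comm]
    rw [h1, mul_smul, mul_smul]
    set u : Cinf n := sig n p • h
    have h2 := integral_mul_fderiv_eq_neg_fderiv_mul_of_integrable (μ := MeasureTheory.volume)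
      (f := g.1) (g := u.1) (v := Pi.single i 1)
      (by
        have := int_mul ((X i : MvPolynomial (Fin n) ℂ) • g) u (cs_smul _ g hg)
        simpa only [X_smul_apply] using this)
      (by
        have := int_mul g ((X i : MvPolynomial (Fin n) ℂ) • u) hg
        simpa only [X_smul_apply] using this)
      (int_mul g u hg)
      (fun x _ => Cinf.differentiable g x) (fun x _ => Cinf.differentiable u x)
    simp only [C_smul_apply, X_smul_apply]
    have h3 : ∀ x, g.1 x * ((algebraMap ℂ ℂ) (-1) * (fderiv ℝ u.1 x) (Pi.single i 1))
        = -(g.1 x * (fderiv ℝ u.1 x) (Pi.single i 1)) := fun x => by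
      simp
    simp only [h3]
    rw [MeasureTheory.integral_neg, h2, neg_neg]

theorem surj_smul (q : MvPolynomial (Fin n) ℂ) (hq : q ≠ 0) (f : Cinf n) : ∃ h : Cinf n, q • h = f := by
  obtain ⟨h, hh⟩ := (baer_complex n).extension_property
    (LinearMap.toSpanSingleton (MvPolynomial (Fin n) ℂ) (MvPolynomial (Fin n) ℂ) q)
    (fun a b hab => by
      simp only [LinearMap.toSpanSingleton_apply, smul_eq_mul] at hab
      exact mul_right_cancel₀ hq hab)
    (LinearMap.toSpanSingleton (MvPolynomial (Fin n) ℂ) (Cinf n) f)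
  refine ⟨h 1, ?_⟩
  have := LinearMap.congr_fun hh 1
  rw [LinearMap.comp_apply, LinearMap.toSpanSingleton_apply, LinearMap.toSpanSingleton_apply, one_smul,
    one_smul] at this
  rw [← map_smul, smul_eq_mul, mul_one, this]

theorem eq_zero_of_cs (q : MvPolynomial (Fin n) ℂ) (hq : q ≠ 0) (g : Cinf n)
    (hg : HasCompactSupport g.1) (h0 : q • g = 0) : g = 0 := by
  let gc : Cinf n := ⟨fun x => (starRingEnd ℂ) (g.1 x), Complex.conjCLE.contDiff.comp (Cinf.contDiff g)⟩
  have hs : sig n q ≠ 0 := fun h => hq (by rw [← sig_sig q, h, map_zero])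
  obtain ⟨h, hh⟩ := surj_smul (sig n q) hs gc
  have h1 := parts q g h hg
  rw [h0, hh] at h1
  have h2 : ∀ x, g.1 x * gc.1 x = ((‖g.1 x‖ ^ 2 : ℝ) : ℂ) := fun x => by
    change g.1 x * (starRingEnd ℂ) (g.1 x) = _
    rw [Complex.mul_conj, Complex.normSq_eq_norm_sq]
  simp only [h2, zero_apply', zero_mul, MeasureTheory.integral_zero] at h1
  rw [integral_complex_ofReal] at h1
  have h3 : ∫ x, ‖g.1 x‖ ^ 2 = 0 := by exact_mod_cast h1.symm
  have hc : Continuous fun x => ‖g.1 x‖ ^ 2 := (Cinf.continuous g).norm.pow 2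
  have hi : MeasureTheory.Integrable fun x => ‖g.1 x‖ ^ 2 :=
    hc.integrable_of_hasCompactSupport (hg.norm.comp_left (g := fun t : ℝ => t ^ 2) (by norm_num))
  rw [MeasureTheory.integral_eq_zero_iff_of_nonneg (fun x => by positivity) hi] at h3
  have h4 := (hc.ae_eq_iff_eq MeasureTheory.volume continuous_const).1 h3
  refine Subtype.ext (funext fun x => ?_)
  have h5 : ‖g.1 x‖ ^ 2 = 0 := congrFun h4 x
  exact norm_eq_zero.1 (pow_eq_zero_iff (two_ne_zero) |>.1 h5)

variable {k ℓ : ℕ} (M : Matrix (Fin ℓ) (Fin k) (MvPolynomial (Fin n) ℂ))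

abbrev rowsp : Submodule (MvPolynomial (Fin n) ℂ) (Fin k → MvPolynomial (Fin n) ℂ) :=
  Submodule.span (MvPolynomial (Fin n) ℂ) (Set.range fun i j => M i j)

variable {M}

theorem sys_hom (f : Fin k → Cinf n) (hf : f ∈ system M) :
    ∃ ψ : ((Fin k → MvPolynomial (Fin n) ℂ) ⧸ rowsp M) →ₗ[MvPolynomial (Fin n) ℂ] Cinf n,
      ∀ y, ψ (Submodule.Quotient.mk y) = ∑ j, y j • f j := by
  refine ⟨(rowsp M).liftQ (Fintype.linearCombination (MvPolynomial (Fin n) ℂ) f) ?_, fun y => ?_⟩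
  · rw [Submodule.span_le]
    rintro _ ⟨i, rfl⟩
    exact hf i
  · rw [Submodule.liftQ_apply, Fintype.linearCombination_apply]

theorem hom_apply (ψ : ((Fin k → MvPolynomial (Fin n) ℂ) ⧸ rowsp M) →ₗ[MvPolynomial (Fin n) ℂ] Cinf n)
    (y : Fin k → MvPolynomial (Fin n) ℂ) :
    ψ (Submodule.Quotient.mk y) = ∑ j, y j • ψ (Submodule.Quotient.mk (Pi.single j 1)) := by
  conv_lhs => rw [pi_eq_sum_univ' y]
  change ψ ((rowsp M).mkQ _) = _
  rw [map_sum, map_sum]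
  refine Finset.sum_congr rfl fun j _ => ?_
  rw [map_smul, map_smul]
  congr 3

theorem hom_sys (ψ : ((Fin k → MvPolynomial (Fin n) ℂ) ⧸ rowsp M) →ₗ[MvPolynomial (Fin n) ℂ] Cinf n) :
    (fun j => ψ (Submodule.Quotient.mk (Pi.single j 1))) ∈ system M := by
  intro i
  have h1 := hom_apply ψ (fun j => M i j)
  have h2 : (Submodule.Quotient.mk (fun j => M i j) : (Fin k → MvPolynomial (Fin n) ℂ) ⧸ rowsp M) = 0 :=
    (Submodule.Quotient.mk_eq_zero _).2 (Submodule.subset_span ⟨i, rfl⟩)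
  rw [h2, map_zero] at h1
  exact h1.symm

def expC (ζ : Fin n → ℂ) : Cinf n :=
  ⟨fun x => Complex.exp (gradCLM ζ x), show ContDiff ℝ ∞ _ from (gradCLM ζ).contDiff.cexp⟩

theorem X_expC (ζ : Fin n → ℂ) (m : Fin n) :
    (X m : MvPolynomial (Fin n) ℂ) • expC ζ = ζ m • expC ζ := by
  refine Subtype.ext (funext fun x => ?_)
  rw [X_smul_apply]
  have h : HasFDerivAt (expC ζ).1 (Complex.exp (gradCLM ζ x) • gradCLM ζ) x :=
    (gradCLM ζ).hasFDerivAt.cexp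
  rw [h.fderiv, _root_.smul_apply, gradCLM_single, smul_eq_mul, mul_comm]
  rfl

/-- the system separates nonzero elements of the quotient module -/
theorem separates (y : Fin k → MvPolynomial (Fin n) ℂ)
    (h : ∀ f ∈ system M, ∑ j, y j • f j = 0) :
    (Submodule.Quotient.mk y : (Fin k → MvPolynomial (Fin n) ℂ) ⧸ rowsp M) = 0 := by
  by_contra h0
  set m : (Fin k → MvPolynomial (Fin n) ℂ) ⧸ rowsp M := Submodule.Quotient.mk y with hm
  let t := LinearMap.toSpanSingleton (MvPolynomial (Fin n) ℂ)
    ((Fin k → MvPolynomial (Fin n) ℂ) ⧸ rowsp M) m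
  let I : Ideal (MvPolynomial (Fin n) ℂ) := LinearMap.ker t
  have hI : I ≠ ⊤ := by
    intro hI
    have : (1 : MvPolynomial (Fin n) ℂ) ∈ I := hI ▸ Submodule.mem_top
    rw [LinearMap.mem_ker, LinearMap.toSpanSingleton_apply, one_smul] at this
    exact h0 this
  obtain ⟨mx, hmx, hle⟩ := Ideal.exists_le_maximal I hI
  obtain ⟨ζ, hζ⟩ := isMaximal_iff_eq_vanishingIdeal_singleton.1 hmx
  let s : (MvPolynomial (Fin n) ℂ ⧸ I) →ₗ[MvPolynomial (Fin n) ℂ] Cinf n :=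
    Submodule.liftQ I (LinearMap.toSpanSingleton (MvPolynomial (Fin n) ℂ) (Cinf n) (expC ζ)) (by
      intro p hp
      have hp2 := hle hp
      rw [hζ, mem_vanishingIdeal_singleton_iff] at hp2
      rw [LinearMap.mem_ker, LinearMap.toSpanSingleton_apply, smul_eq_aeval ζ _ (X_expC ζ), hp2,
        zero_smul])
  let ι : (MvPolynomial (Fin n) ℂ ⧸ I) →ₗ[MvPolynomial (Fin n) ℂ]
      ((Fin k → MvPolynomial (Fin n) ℂ) ⧸ rowsp M) := Submodule.liftQ I t le_rfl
  have hι : Function.Injective ι := by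
    rw [← LinearMap.ker_eq_bot]
    exact Submodule.ker_liftQ_eq_bot _ _ _ le_rfl
  obtain ⟨ψ, hψ⟩ := (baer_complex n).extension_property ι hι s
  have h1 := LinearMap.congr_fun hψ (Submodule.Quotient.mk 1)
  rw [LinearMap.comp_apply] at h1
  have h2 : ι (Submodule.Quotient.mk 1) = m := by
    change t 1 = m
    rw [LinearMap.toSpanSingleton_apply, one_smul]
  have h3 : s (Submodule.Quotient.mk 1) = expC ζ := by
    change (LinearMap.toSpanSingleton (MvPolynomial (Fin n) ℂ) (Cinf n) (expC ζ)) 1 = _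
    rw [LinearMap.toSpanSingleton_apply, one_smul]
  rw [h2, h3, hm, hom_apply, h _ (hom_sys ψ)] at h1
  have h4 : (0 : ℂ) = Complex.exp (gradCLM ζ 0) := congrFun (congrArg Subtype.val h1) 0
  exact Complex.exp_ne_zero _ h4.symm

theorem sum_val {ι : Type} (s : Finset ι) (f : ι → Cinf n) (x : Fin n → ℝ) :
    (∑ i ∈ s, f i).1 x = ∑ i ∈ s, (f i).1 x := by
  classical
  induction s using Finset.induction_on with
  | empty => rfl
  | insert a s ha ih => rw [Finset.sum_insert ha, Finset.sum_insert ha, add_apply', ih]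

theorem torsionFree_of_controllable (h : IsControllable (system M)) (p : MvPolynomial (Fin n) ℂ)
    (hp : p ≠ 0) (m : (Fin k → MvPolynomial (Fin n) ℂ) ⧸ rowsp M) (hm : p • m = 0) : m = 0 := by
  obtain ⟨y, rfl⟩ := Submodule.Quotient.mk_surjective _ m
  refine separates y fun f hf => Subtype.ext (funext fun x0 => ?_)
  set r : ℝ := ‖x0‖ + 1
  have hz : (0 : Fin k → Cinf n) ∈ system M := fun i => by simp
  obtain ⟨f', hf', V1, V2, hV1, hV2, hU1, hU2, he1, he2⟩ :=
    h (Metric.ball 0 r) (Metric.ball 0 (r + 1))ᶜ (by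
      rw [Metric.isOpen_ball.isClosed_compl.closure_eq]
      ext x
      simp only [Set.mem_inter_iff, Set.mem_empty_iff_false, iff_false, not_and]
      intro hx hx2
      have hx3 := Metric.closure_ball_subset_closedBall hx
      rw [Metric.mem_closedBall] at hx3
      exact hx2 (Metric.mem_ball.2 (by linarith))) f hf 0 hz
  obtain ⟨ψ, hψ⟩ := sys_hom f' hf'
  have hg0 : ∑ j, y j • f' j = 0 := by
    refine eq_zero_of_cs p hp _ (HasCompactSupport.intro (isCompact_closedBall 0 (r + 1)) fun x hx => ?_) ?_
    · rw [sum_val]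
      refine Finset.sum_eq_zero fun j _ => ?_
      have hx2 : x ∈ V2 := hU2 fun hb => hx (Metric.ball_subset_closedBall hb)
      rw [poly_smul_congr (y j) V2 hV2 (f' j) 0 (fun z hz => he2 z hz j) x hx2, smul_zero]
      rfl
    · rw [← hψ, ← map_smul, hm, map_zero]
  have hx0 : x0 ∈ V1 := hU1 (by rw [mem_ball_zero_iff]; exact lt_add_one _)
  rw [← hg0, sum_val, sum_val]
  exact Finset.sum_congr rfl fun j _ =>
    (poly_smul_congr (y j) V1 hV1 (f' j) (f j) (fun z hz => he1 z hz j) x0 hx0).symm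

theorem free_congr {s : Type} (h1 h2 : (s →₀ MvPolynomial (Fin n) ℂ) →ₗ[MvPolynomial (Fin n) ℂ] Cinf n)
    (V : Set (Fin n → ℝ)) (hV : IsOpen V)
    (h : ∀ a, ∀ x ∈ V, (h1 (Finsupp.single a 1)).1 x = (h2 (Finsupp.single a 1)).1 x)
    (y : s →₀ MvPolynomial (Fin n) ℂ) : ∀ x ∈ V, (h1 y).1 x = (h2 y).1 x := by
  intro x hx
  induction y using Finsupp.induction_linear with
  | zero => rw [map_zero, map_zero]
  | add a b ha hb => rw [map_add, map_add, add_apply', add_apply', ha, hb]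
  | single a p =>
    have : Finsupp.single a p = p • Finsupp.single a (1 : MvPolynomial (Fin n) ℂ) := by simp
    rw [this, map_smul, map_smul]
    exact poly_smul_congr p V hV _ _ (h a) x hx

theorem controllable_of_torsionFree
    (ht : ∀ p : MvPolynomial (Fin n) ℂ, p ≠ 0 →
      ∀ m : (Fin k → MvPolynomial (Fin n) ℂ) ⧸ rowsp M, p • m = 0 → m = 0) :
    IsControllable (system M) := by
  intro U₁ U₂ hU f₁ hf₁ f₂ hf₂
  obtain ⟨ψ₁, hψ₁⟩ := sys_hom f₁ hf₁
  obtain ⟨ψ₂, hψ₂⟩ := sys_hom f₂ hf₂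
  obtain ⟨s, e, he⟩ := embed_free
    (fun j => (Submodule.Quotient.mk (Pi.single j 1) : (Fin k → MvPolynomial (Fin n) ℂ) ⧸ rowsp M))
    (by
      rw [eq_top_iff]
      rintro m -
      obtain ⟨y, rfl⟩ := Submodule.Quotient.mk_surjective _ m
      rw [pi_eq_sum_univ' y]
      change (rowsp M).mkQ _ ∈ _
      rw [map_sum]
      refine Submodule.sum_mem _ fun j _ => ?_
      rw [map_smul]
      refine Submodule.smul_mem _ _ (Submodule.subset_span ⟨j, ?_⟩)
      change (rowsp M).mkQ _ = _
      congr 1) ht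
  obtain ⟨h₁, hh₁⟩ := (baer_complex n).extension_property e he ψ₁
  obtain ⟨h₂, hh₂⟩ := (baer_complex n).extension_property e he ψ₂
  obtain ⟨χ, hχ0, hχ1, -⟩ := exists_contMDiffMap_zero_one_nhds_of_isClosed (n := ⊤)
    (modelWithCornersSelf ℝ (Fin n → ℝ)) (isClosed_closure (s := U₁)) (isClosed_closure (s := U₂))
    (Set.disjoint_iff_inter_eq_empty.2 hU)
  have hχ : ContDiff ℝ ∞ χ := χ.contMDiff.contDiff
  have hχc : ContDiff ℝ ∞ (fun x => (χ x : ℂ)) := Complex.ofRealCLM.contDiff.comp hχ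
  let patch : Cinf n → Cinf n → Cinf n := fun a b =>
    ⟨fun x => (1 - (χ x : ℂ)) * a.1 x + (χ x : ℂ) * b.1 x,
      ((contDiff_const.sub hχc).mul (Cinf.contDiff a)).add (hχc.mul (Cinf.contDiff b))⟩
  have hpatch : ∀ a b x, (patch a b).1 x = (1 - (χ x : ℂ)) * a.1 x + (χ x : ℂ) * b.1 x :=
    fun a b x => rfl
  let h := Finsupp.linearCombination (MvPolynomial (Fin n) ℂ)
    (fun a : s => patch (h₁ (Finsupp.single a 1)) (h₂ (Finsupp.single a 1)))
  have hh : ∀ a : s, h (Finsupp.single a 1) = patch (h₁ (Finsupp.single a 1)) (h₂ (Finsupp.single a 1)) :=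
    fun a => by rw [Finsupp.linearCombination_single, one_smul]
  obtain ⟨V₁, hV₁, hUV₁, hVχ₁⟩ := mem_nhdsSet_iff_exists.1 hχ0
  obtain ⟨V₂, hV₂, hUV₂, hVχ₂⟩ := mem_nhdsSet_iff_exists.1 hχ1
  have hs : ∀ (f : Fin k → Cinf n) (ψ : ((Fin k → MvPolynomial (Fin n) ℂ) ⧸ rowsp M)
      →ₗ[MvPolynomial (Fin n) ℂ] Cinf n), (∀ y, ψ (Submodule.Quotient.mk y) = ∑ j, y j • f j) →
      ∀ j, ψ (Submodule.Quotient.mk (Pi.single j 1)) = f j := by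
    intro f ψ hψ j
    rw [hψ, Finset.sum_eq_single j]
    · rw [Pi.single_eq_same, one_smul]
    · intro b _ hb
      rw [Pi.single_eq_of_ne hb, zero_smul]
    · intro hj
      exact absurd (Finset.mem_univ j) hj
  refine ⟨_, hom_sys (h ∘ₗ e), V₁, V₂, hV₁, hV₂, subset_closure.trans hUV₁, subset_closure.trans hUV₂,
    fun x hx j => ?_, fun x hx j => ?_⟩
  · rw [← hs f₁ ψ₁ hψ₁ j, ← hh₁]
    refine free_congr h h₁ V₁ hV₁ (fun a z hz => ?_) _ x hx
    have : χ z = 0 := hVχ₁ hz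
    rw [hh, hpatch, this]
    simp
  · rw [← hs f₂ ψ₂ hψ₂ j, ← hh₂]
    refine free_congr h h₂ V₂ hV₂ (fun a z hz => ?_) _ x hx
    have : χ z = 1 := hVχ₂ hz
    rw [hh, hpatch, this]
    simp

end Final

end

/-- **Theorem 1.1** (Pillai–Shankar). The distributed system `ℬ(P)` defined by the submodule
`P ⊆ A^k` generated by the rows of the matrix `M` is controllable if and only if the
`A`-module `A^k/P` is torsion-free. -/
theorem controllable_iff_torsionFree (n k ℓ : ℕ) (hn : 0 < n) (hk : 0 < k) (hl : 0 < ℓ)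
    [Module (MvPolynomial (Fin n) ℂ) (Cinf n)]
    (hX : ∀ (i : Fin n) (f : Cinf n),
      (((MvPolynomial.X i : MvPolynomial (Fin n) ℂ) • f : Cinf n) : (Fin n → ℝ) → ℂ) =
        fun x => fderiv ℝ (f : (Fin n → ℝ) → ℂ) x (Pi.single i 1))
    (hC : ∀ (c : ℂ) (f : Cinf n),
      ((MvPolynomial.C c : MvPolynomial (Fin n) ℂ) • f : Cinf n) = c • f)
    (M : Matrix (Fin ℓ) (Fin k) (MvPolynomial (Fin n) ℂ)) :
    IsControllable (system M) ↔
      ∀ p : MvPolynomial (Fin n) ℂ, p ≠ 0 →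
        ∀ m : (Fin k → MvPolynomial (Fin n) ℂ) ⧸
            Submodule.span (MvPolynomial (Fin n) ℂ) (Set.range fun i j => M i j),
          p • m = 0 → m = 0 := by
  have hD : DMod n ℂ := ⟨hX, fun c f => hC c f⟩
  exact ⟨fun h p hp m hm => torsionFree_of_controllable h p hp m hm,
    fun ht => controllable_of_torsionFree ht⟩
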